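/- arXiv:2107.00335 — 2 statements merged into one kernel-verified Lean document; each statement's English description precedes it below -/
import Mathlib

section
/- Let 0 < ε < 1/10000. If Γ₀ and Γ₁ are two connected closed embedded curves in ℝ³ such that (i) Γ₀ is a C¹ curve whose unit tangent vector field T satisfies |T(x) − T(y)| ≤ ε for all x, y ∈ Γ₀ with dist_{Γ₀}(x, y) ≤ 1, (ii) Length(Γ₀) ≥ 1, and (iii) Γ₀ ⊔ Γ₁ = ∂Σ for a smoothly embedded compact annulus Σ ⊂ ℝ³ with Area(Σ) ≤ ε², then Length(Γ₁) ≥ (1 − Cε)·Length(Γ₀), where C is a universal positive constant. -/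
open MeasureTheory Set

noncomputable section

abbrev E3 := EuclideanSpace ℝ (Fin 3)

/-- The annulus `Σ ⊂ ℝ³`, parametrized by a map `f` on the strip `ℝ × [0,1]`
(periodic of period 1 in the first variable). -/
def annulusSet (f : ℝ × ℝ → E3) : Set E3 := f '' (Set.univ ×ˢ Set.Icc (0 : ℝ) 1)

open Filter Topology in
/-- Eilenberg's inequality. -/
lemma eilenberg (E : Set E3) (g : E3 → ℝ) (hg : LipschitzWith 1 g) :
    ∫⁻ c : ℝ, μH[1] (E ∩ g ⁻¹' {c}) ≤ μH[2] E := by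
  by_cases htop : μH[2] E = ⊤
  · rw [htop]; exact le_top
  have hcov : ∀ n : ℕ, ∃ t : ℕ → Set E3, E ⊆ ⋃ i, t i ∧ (∀ i, Metric.ediam (t i) ≤ (n + 1 : ENNReal)⁻¹) ∧
      ∑' i, (⨆ _ : (t i).Nonempty, Metric.ediam (t i) ^ (2:ℝ)) ≤ μH[2] E + (n + 1 : ENNReal)⁻¹ := by
    intro n
    have hn : (0 : ENNReal) < (n + 1 : ENNReal)⁻¹ := by
      rw [ENNReal.inv_pos]; exact ENNReal.add_ne_top.2 ⟨ENNReal.natCast_ne_top n, ENNReal.one_ne_top⟩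
    have hlt : (⨅ (t : ℕ → Set E3) (_ : E ⊆ ⋃ n, t n) (_ : ∀ i, Metric.ediam (t i) ≤ (n + 1 : ENNReal)⁻¹),
          ∑' i, ⨆ _ : (t i).Nonempty, Metric.ediam (t i) ^ (2:ℝ)) < μH[2] E + (n + 1 : ENNReal)⁻¹ := by
      refine lt_of_le_of_lt ?_ (ENNReal.lt_add_right htop hn.ne')
      rw [Measure.hausdorffMeasure_apply]
      exact le_iSup₂ (f := fun (r : ENNReal) (_ : 0 < r) => ⨅ (t : ℕ → Set E3) (_ : E ⊆ ⋃ n, t n) (_ : ∀ i, Metric.ediam (t i) ≤ r),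
          ∑' i, ⨆ _ : (t i).Nonempty, Metric.ediam (t i) ^ (2:ℝ)) _ hn
    simp only [iInf_lt_iff] at hlt
    obtain ⟨t, h1, h2, h3⟩ := hlt
    exact ⟨t, h1, h2, h3.le⟩
  choose t ht1 ht2 ht3 using hcov
  have htend : Tendsto (fun n : ℕ => (n + 1 : ENNReal)⁻¹) atTop (𝓝 0) := by
    have := (tendsto_add_atTop_iff_nat 1).2 ENNReal.tendsto_inv_nat_nhds_zero
    simpa using this
  set G : ℕ → ℝ → ENNReal := fun n c =>
    ∑' i, (closure (g '' t n i)).indicator (fun _ => Metric.ediam (t n i)) c with hG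
  have hGm : ∀ n, Measurable (G n) := fun n =>
    Measurable.tsum fun i => measurable_const.indicator isClosed_closure.measurableSet
  have hGi : ∀ n, ∫⁻ c, G n c ≤ μH[2] E + (n + 1 : ENNReal)⁻¹ := by
    intro n
    refine le_trans ?_ (ht3 n)
    rw [lintegral_tsum fun i =>
      (measurable_const.indicator isClosed_closure.measurableSet).aemeasurable]
    refine ENNReal.tsum_le_tsum fun i => ?_
    rw [lintegral_indicator isClosed_closure.measurableSet, setLIntegral_const]
    rcases (t n i).eq_empty_or_nonempty with h | h
    · simp [h]
    · rw [ciSup_pos h, ENNReal.rpow_two, sq]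
      gcongr
      refine (Real.volume_le_diam _).trans ?_
      rw [Metric.ediam_closure]
      simpa using hg.ediam_image_le (t n i)
  have hle : ∀ c, μH[1] (E ∩ g ⁻¹' {c}) ≤ liminf (fun n => G n c) atTop := by
    intro c
    have := Measure.hausdorffMeasure_le_liminf_tsum (ι := fun _ : ℕ => ℕ) 1 (E ∩ g ⁻¹' {c})
      (l := atTop) (fun n : ℕ => (n + 1 : ENNReal)⁻¹) htend
      (fun n i => t n i ∩ g ⁻¹' {c})
      (Eventually.of_forall fun n i => (Metric.ediam_mono inter_subset_left).trans (ht2 n i))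
      (Eventually.of_forall fun n p hp => by
        obtain ⟨i, hi⟩ := mem_iUnion.1 (ht1 n hp.1)
        exact mem_iUnion.2 ⟨i, hi, hp.2⟩)
    refine this.trans (liminf_le_liminf (Eventually.of_forall fun n => ?_))
    refine ENNReal.tsum_le_tsum fun i => ?_
    rw [ENNReal.rpow_one]
    rcases (t n i ∩ g ⁻¹' {c}).eq_empty_or_nonempty with h | ⟨p, hp⟩
    · rw [h]; simp
    · rw [indicator_of_mem (subset_closure (show c ∈ g '' t n i from ⟨p, hp.1, hp.2⟩))]
      exact Metric.ediam_mono inter_subset_left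
  calc ∫⁻ c : ℝ, μH[1] (E ∩ g ⁻¹' {c}) ≤ ∫⁻ c, liminf (fun n => G n c) atTop := lintegral_mono hle
    _ ≤ liminf (fun n => ∫⁻ c, G n c) atTop := lintegral_liminf_le hGm
    _ ≤ liminf (fun n : ℕ => μH[2] E + (n + 1 : ENNReal)⁻¹) atTop :=
        liminf_le_liminf (Eventually.of_forall hGi)
    _ = μH[2] E := by
        have : Tendsto (fun n : ℕ => μH[2] E + (n + 1 : ENNReal)⁻¹) atTop (𝓝 (μH[2] E + 0)) :=
          htend.const_add _
        rw [this.liminf_eq, add_zero]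

/-- lower bound of `μH[1]` through a 1-Lipschitz function -/
lemma le_hausdorff_of_values (S : Set E3) (g : E3 → ℝ) (hg : LipschitzWith 1 g) (a b : ℝ)
    (h : ∀ c ∈ Ioo a b, ∃ p ∈ S, g p = c) : ENNReal.ofReal (b - a) ≤ μH[1] S := by
  have h1 := hg.hausdorffMeasure_image_le (d := 1) zero_le_one S
  rw [hausdorffMeasure_real] at h1
  simp at h1
  refine le_trans ?_ h1
  rw [← Real.volume_Ioo]
  exact measure_mono fun c hc => h c hc

/-- connected set: distance bounded by `μH[1]` -/
lemma dist_le_hausdorff (S : Set E3) (hS : IsPreconnected S) (p q : E3) (hp : p ∈ S) (hq : q ∈ S) :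
    ENNReal.ofReal (dist p q) ≤ μH[1] S := by
  have := le_hausdorff_of_values S (fun z => dist z q) (LipschitzWith.dist_left q) 0 (dist p q)
    (fun c hc => by
      obtain ⟨z, hz, hzc⟩ := (hS.image (fun z => dist z q) (by fun_prop)).ordConnected.out
        (mem_image_of_mem _ hq) (mem_image_of_mem _ hp) (show c ∈ _ from
          ⟨by simpa using hc.1.le, hc.2.le⟩)
      exact ⟨z, hz, hzc⟩)
  simpa using this
/-- Separation of a component from a closed set by a clopen set. -/
lemma clopen_sep {X : Type*} [TopologicalSpace X] [T2Space X] [CompactSpace X] (x : X)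
    (B : Set X) (hB : IsClosed B) (h : connectedComponent x ∩ B = ∅) :
    ∃ V : Set X, IsClopen V ∧ x ∈ V ∧ V ∩ B = ∅ := by
  rw [connectedComponent_eq_iInter_isClopen, inter_comm] at h
  obtain ⟨fin, hf⟩ := hB.isCompact.elim_finite_subfamily_closed
    (fun s : { s : Set X // IsClopen s ∧ x ∈ s } => (s : Set X)) (fun s => s.2.1.1) h
  refine ⟨⋂ i ∈ fin, (i : Set X), isClopen_biInter_finset fun i _ => i.2.1,
    mem_iInter₂.2 fun s _ => s.2.2, ?_⟩
  rw [inter_comm]; exact hf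

/-- Continuous angle for a nonvanishing map on the plane. -/
lemma exists_angle (W : ℝ × ℝ → ℂ) (hW : Continuous W) (h0 : ∀ p, W p ≠ 0) :
    ∃ θ : ℝ × ℝ → ℝ, Continuous θ ∧ ∃ r : ℝ × ℝ → ℝ, (∀ p, 0 < r p) ∧
      (∀ p, (W p).re = r p * Real.cos (θ p)) ∧ (∀ p, (W p).im = r p * Real.sin (θ p)) := by
  obtain ⟨G, ⟨-, hG⟩, -⟩ := Complex.isCoveringMapOn_exp.existsUnique_continuousMap_lifts
    (⟨W, hW⟩ : C(ℝ × ℝ, ℂ)) (a₀ := (0, 0)) (e₀ := Complex.log (W (0, 0)))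
    (by simpa using Complex.exp_log (h0 _)) (fun a => by simpa using h0 a)
  have hG' : ∀ p, Complex.exp (G p) = W p := fun p => congrFun hG p
  refine ⟨fun p => (G p).im, by fun_prop, fun p => Real.exp (G p).re,
    fun p => Real.exp_pos _, fun p => ?_, fun p => ?_⟩
  · rw [← hG', Complex.exp_re]
  · rw [← hG', Complex.exp_im]

/-- The winding argument. `S` is a connected set where `v > 0` containing both `(P,0)` and `(Q,0)`. -/
lemma winding_contra (u v : ℝ × ℝ → ℝ) (hu : Continuous u) (hv : Continuous v)
    (h0 : ∀ p, u p = 0 → v p ≠ 0) (S : Set (ℝ × ℝ)) (hS : IsPreconnected S)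
    (hSv : ∀ p ∈ S, 0 < v p) (P t Q : ℝ) (hPt : P < t) (htQ : t < Q)
    (hP : (P, (0:ℝ)) ∈ S) (hQ : (Q, (0:ℝ)) ∈ S)
    (hneg : ∀ x ∈ Ico P t, u (x, 0) < 0) (hpos : ∀ x ∈ Ioc t Q, 0 < u (x, 0))
    (ht : u (t, 0) = 0) (htv : v (t, 0) < 0) : False := by
  obtain ⟨θ, hθ, r, hr, hre, him⟩ := exists_angle (fun p => (u p : ℂ) + (v p : ℂ) * Complex.I)
    (by fun_prop) (fun p hp => by
      have h1 := congrArg Complex.re hp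
      have h2 := congrArg Complex.im hp
      simp at h1 h2
      exact h0 p h1 h2)
  simp at hre him
  -- normalise
  set m : ℤ := ⌊θ (P, 0) / (2 * Real.pi)⌋ with hm
  have hpi := Real.pi_pos
  set φ : ℝ × ℝ → ℝ := fun p => θ p - m * (2 * Real.pi) with hφ
  have hφc : Continuous φ := by fun_prop
  have hcos : ∀ p, u p = r p * Real.cos (φ p) := fun p => by
    rw [hre, hφ]; simp [Real.cos_sub_int_mul_two_pi]
  have hsin : ∀ p, v p = r p * Real.sin (φ p) := fun p => by
    rw [him, hφ]; simp [Real.sin_sub_int_mul_two_pi]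
  have hP0 : 0 ≤ φ (P, 0) := by
    have := Int.floor_le (θ (P, 0) / (2 * Real.pi))
    rw [← hm, le_div_iff₀ (by positivity)] at this
    simp only [hφ]; linarith
  have hP1 : φ (P, 0) < 2 * Real.pi := by
    have := Int.lt_floor_add_one (θ (P, 0) / (2 * Real.pi))
    rw [← hm, div_lt_iff₀ (by positivity)] at this
    simp only [hφ]; linarith
  have hsS : ∀ p ∈ S, 0 < Real.sin (φ p) := fun p hp => by
    have := hSv p hp; rw [hsin] at this; exact pos_of_mul_pos_right this (hr p).le
  have hP2 : φ (P, 0) < Real.pi := by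
    by_contra hc
    push Not at hc
    have h1 := hsS _ hP
    have : Real.sin (φ (P, 0)) ≤ 0 := by
      have h3 := Real.sin_nonneg_of_nonneg_of_le_pi (x := φ (P, 0) - Real.pi) (by linarith)
        (by linarith)
      rw [Real.sin_sub_pi] at h3; linarith
    linarith
  -- S stays in (0, π)
  have hord := (hS.image φ hφc.continuousOn).ordConnected
  have hQ1 : 0 < φ (Q, 0) := by
    by_contra hc
    push Not at hc
    obtain ⟨p, hp, hp0⟩ := hord.out (mem_image_of_mem φ hQ) (mem_image_of_mem φ hP)
      (show (0:ℝ) ∈ _ from ⟨hc, hP0⟩)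
    have := hsS p hp
    rw [hp0] at this; simp at this
  have hQ2 : φ (Q, 0) < Real.pi := by
    by_contra hc
    push Not at hc
    obtain ⟨p, hp, hp0⟩ := hord.out (mem_image_of_mem φ hP) (mem_image_of_mem φ hQ)
      (show Real.pi ∈ _ from ⟨hP2.le, hc⟩)
    have := hsS p hp
    rw [hp0] at this; simp at this
  have hts : Real.sin (φ (t, 0)) < 0 := by
    rw [hsin] at htv; by_contra hc; push Not at hc
    have := mul_nonneg (hr (t, 0)).le hc; linarith
  -- left: `0 < φ (t,0) < 2π`
  have hcn : ∀ x ∈ Icc P t, Real.cos (φ (x, 0)) ≤ 0 := fun x hx => by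
    by_contra hc
    push Not at hc
    have h1 := mul_pos (hr (x, 0)) hc
    rw [← hcos] at h1
    rcases hx.2.lt_or_eq with h | h
    · have := hneg x ⟨hx.1, h⟩; linarith
    · rw [h, ht] at h1; exact lt_irrefl _ h1
  have hcp : ∀ x ∈ Icc t Q, 0 ≤ Real.cos (φ (x, 0)) := fun x hx => by
    by_contra hc
    push Not at hc
    have h1 := mul_neg_of_pos_of_neg (hr (x, 0)) hc
    rw [← hcos] at h1
    rcases hx.1.lt_or_eq with h | h
    · have := hpos x ⟨h, hx.2⟩; linarith
    · rw [← h, ht] at h1; exact lt_irrefl _ h1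
  have hφ1 : Continuous fun x : ℝ => φ (x, 0) := by fun_prop
  have ht0 : 0 < φ (t, 0) := by
    by_contra hc
    push Not at hc
    obtain ⟨x, hx, hx0⟩ := intermediate_value_Icc' hPt.le hφ1.continuousOn
      (show (0:ℝ) ∈ Icc (φ (t, 0)) (φ (P, 0)) from ⟨hc, hP0⟩)
    have := hcn x hx
    simp only at hx0
    rw [hx0] at this; simp at this; linarith
  have htpi : φ (t, 0) < Real.pi := by
    by_contra hc
    push Not at hc
    obtain ⟨x, hx, hx0⟩ := intermediate_value_Icc' htQ.le hφ1.continuousOn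
      (show Real.pi ∈ Icc (φ (Q, 0)) (φ (t, 0)) from ⟨hQ2.le, hc⟩)
    have := hcp x hx
    simp only at hx0
    rw [hx0] at this; simp at this; linarith
  have := Real.sin_pos_of_pos_of_lt_pi ht0 htpi
  linarith

/-- Exit lemma. -/
lemma exit_lemma (u : ℝ × ℝ → ℝ) (hu : Continuous u) (K : Set (ℝ × ℝ)) (hK : IsCompact K)
    (hKc : IsPreconnected K) (hKs : ∀ p ∈ K, p.2 ∈ Icc (0:ℝ) 1) (a t b : ℝ)
    (hat : a < t) (htb : t < b) (ha : (a, (0:ℝ)) ∈ K) (hb : (b, (0:ℝ)) ∈ K)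
    (η : ℝ) (hη : 0 < η)
    (hneg : ∀ x, t - η ≤ x → x < t → u (x, 0) < 0) (hpos : ∀ x, t < x → x ≤ t + η → 0 < u (x, 0))
    (ht : u (t, 0) = 0) :
    ∃ A : Set (ℝ × ℝ), IsCompact A ∧ IsPreconnected A ∧ (∀ p ∈ A, p.2 ∈ Icc (0:ℝ) 1) ∧
      (∀ p ∈ A, u p = 0) ∧ (t, (0:ℝ)) ∈ A ∧
      ((A ∩ K).Nonempty ∨ ∃ x ∈ Icc a b, x ≠ t ∧ (x, (0:ℝ)) ∈ A) := by
  obtain ⟨η', hη', h1, h2, h3⟩ : ∃ η', 0 < η' ∧ η' ≤ η ∧ a ≤ t - η' ∧ t + η' ≤ b :=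
    ⟨min η (min (t - a) (b - t)), by
      refine lt_min hη (lt_min ?_ ?_) <;> linarith, min_le_left _ _, by
      have := (min_le_right η (min (t - a) (b - t))).trans (min_le_left _ _); linarith, by
      have := (min_le_right η (min (t - a) (b - t))).trans (min_le_right _ _); linarith⟩
  -- rectangle
  obtain ⟨M, hM⟩ : ∃ M : ℝ, ∀ p ∈ K, |p.1| ≤ M := by
    obtain ⟨M, hM⟩ := hK.isBounded.exists_norm_le
    exact ⟨M, fun p hp => (norm_fst_le p).trans (hM p hp)⟩
  have hMa := abs_le.1 (hM _ ha)
  have hMb := abs_le.1 (hM _ hb)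
  simp only at hMa hMb
  set R : Set (ℝ × ℝ) := Icc (-M) M ×ˢ Icc 0 1 with hR
  have hRc : IsCompact R := isCompact_Icc.prod isCompact_Icc
  set Z : Set (ℝ × ℝ) := R ∩ u ⁻¹' {0} with hZ
  have hZc : IsCompact Z := hRc.inter_right (isClosed_singleton.preimage hu)
  have hKR : K ⊆ R := fun p hp => ⟨abs_le.1 (hM p hp), hKs p hp⟩
  have htZ : (t, (0:ℝ)) ∈ Z := ⟨⟨⟨by simp only; linarith, by simp only; linarith⟩, by simp⟩, ht⟩
  have : CompactSpace Z := isCompact_iff_compactSpace.1 hZc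
  set S1 : Set (ℝ × ℝ) := (fun x : ℝ => (x, (0:ℝ))) '' Icc a (t - η') with hS1
  set S2 : Set (ℝ × ℝ) := (fun x : ℝ => (x, (0:ℝ))) '' Icc (t + η') b with hS2
  have hc0 : Continuous fun x : ℝ => (x, (0:ℝ)) := by fun_prop
  have hS1c : IsCompact S1 := isCompact_Icc.image hc0
  have hS2c : IsCompact S2 := isCompact_Icc.image hc0
  set B : Set (ℝ × ℝ) := (S1 ∪ K) ∪ S2 with hB
  have hBc : IsCompact B := (hS1c.union hK).union hS2c
  have hBpre : IsPreconnected B := by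
    refine IsPreconnected.union (b, 0) (Or.inr hb) ⟨b, ⟨h3, le_rfl⟩, rfl⟩ ?_
      (isPreconnected_Icc.image _ hc0.continuousOn)
    exact IsPreconnected.union (a, 0) ⟨a, ⟨le_rfl, h2⟩, rfl⟩ ha
      (isPreconnected_Icc.image _ hc0.continuousOn) hKc
  set C : Set Z := connectedComponent ⟨(t, 0), htZ⟩ with hC
  set A : Set (ℝ × ℝ) := Subtype.val '' C with hA
  refine ⟨A, isClosed_connectedComponent.isCompact.image continuous_subtype_val,
    isPreconnected_connectedComponent.image _ continuous_subtype_val.continuousOn, ?_, ?_,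
    ⟨_, mem_connectedComponent, rfl⟩, ?_⟩
  · rintro _ ⟨p, -, rfl⟩; exact p.2.1.2
  · rintro _ ⟨p, -, rfl⟩; exact p.2.2
  by_contra hcon
  push Not at hcon
  obtain ⟨hc1, hc2⟩ := hcon
  have hAB : C ∩ (Subtype.val ⁻¹' B) = ∅ := by
    rw [eq_empty_iff_forall_notMem]
    rintro p ⟨hpC, hpB⟩
    rcases hpB with (⟨x, hx, hxp⟩ | hp) | ⟨x, hx, hxp⟩
    · exact hc2 x ⟨hx.1, by linarith [hx.2]⟩ (by linarith [hx.2]) ⟨p, hpC, hxp.symm⟩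
    · have : p.1 ∈ A ∩ K := ⟨⟨p, hpC, rfl⟩, hp⟩
      rw [hc1] at this; exact this
    · exact hc2 x ⟨by linarith [hx.1], hx.2⟩ (by linarith [hx.1]) ⟨p, hpC, hxp.symm⟩
  obtain ⟨V, hV, htV, hVB⟩ := clopen_sep _ _ (hBc.isClosed.preimage continuous_subtype_val) hAB
  set Z1 : Set (ℝ × ℝ) := Subtype.val '' V
  set Z2 : Set (ℝ × ℝ) := Subtype.val '' Vᶜ
  have hZ1 : IsClosed Z1 := (hV.isClosed.isCompact.image continuous_subtype_val).isClosed
  have hZ2 : IsClosed Z2 := (hV.compl.isClosed.isCompact.image continuous_subtype_val).isClosed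
  have hdis : Disjoint Z1 (B ∪ Z2) := by
    rw [Set.disjoint_left]
    rintro _ ⟨p, hp, rfl⟩ (h | ⟨q, hq, hqp⟩)
    · have : p ∈ V ∩ Subtype.val ⁻¹' B := ⟨hp, h⟩
      rw [hVB] at this; exact this
    · rw [Subtype.ext hqp] at hq; exact hq hp
  obtain ⟨w, hw0, hw1, -⟩ := exists_continuous_zero_one_of_isClosed hZ1 (hBc.isClosed.union hZ2) hdis
  have hMM : -M ≤ M := by linarith
  set cl : ℝ × ℝ → ℝ × ℝ := fun p => ((projIcc (-M) M hMM p.1 : ℝ), (projIcc (0:ℝ) 1 zero_le_one p.2 : ℝ))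
    with hcl
  have hclc : Continuous cl := by
    refine Continuous.prodMk ?_ ?_
    · exact continuous_subtype_val.comp (continuous_projIcc.comp continuous_fst)
    · exact continuous_subtype_val.comp (continuous_projIcc.comp continuous_snd)
  have hclR : ∀ p, cl p ∈ R := fun p => ⟨Subtype.coe_prop _, Subtype.coe_prop _⟩
  have hclid : ∀ p ∈ R, cl p = p := fun p hp => by
    simp only [hcl]
    rw [projIcc_of_mem hMM hp.1, projIcc_of_mem zero_le_one hp.2]
  have hbot : ∀ x ∈ Icc a b, (x, (0:ℝ)) ∈ R := fun x hx =>
    ⟨⟨by linarith [hx.1], by linarith [hx.2]⟩, by simp⟩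
  have hBR : B ⊆ R := by
    rintro p ((⟨x, hx, rfl⟩ | hp) | ⟨x, hx, rfl⟩)
    · exact hbot x ⟨hx.1, by linarith [hx.2]⟩
    · exact hKR hp
    · exact hbot x ⟨by linarith [hx.1], hx.2⟩
  refine winding_contra (fun p => u (cl p)) (fun p => 2 * w (cl p) - 1) (hu.comp hclc)
    (by fun_prop) ?_ B hBpre ?_ (t - η') t (t + η') (by linarith) (by linarith)
    (Or.inl (Or.inl ⟨_, ⟨h2, le_rfl⟩, rfl⟩)) (Or.inr ⟨_, ⟨le_rfl, h3⟩, rfl⟩) ?_ ?_ ?_ ?_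
  · intro p hp
    have hpZ : cl p ∈ Z := ⟨hclR p, hp⟩
    by_cases hpV : (⟨cl p, hpZ⟩ : Z) ∈ V
    · have := hw0 (show cl p ∈ Z1 from ⟨_, hpV, rfl⟩)
      simp at this ⊢; rw [this]; norm_num
    · have := hw1 (show cl p ∈ B ∪ Z2 from Or.inr ⟨_, hpV, rfl⟩)
      simp at this ⊢; rw [this]; norm_num
  · intro p hp
    have := hw1 (show p ∈ B ∪ Z2 from Or.inl hp)
    rw [hclid p (hBR hp)]; simp at this; rw [this]; norm_num
  · intro x hx
    rw [hclid _ (hbot x ⟨by linarith [hx.1], by linarith [hx.2]⟩)]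
    exact hneg x (by linarith [hx.1]) hx.2
  · intro x hx
    rw [hclid _ (hbot x ⟨by linarith [hx.1], by linarith [hx.2]⟩)]
    exact hpos x hx.1 (by linarith [hx.2])
  · rw [hclid _ (hbot t ⟨hat.le, htb.le⟩)]; exact ht
  · rw [hclid _ (hbot t ⟨hat.le, htb.le⟩)]
    have := hw0 (show (t, (0:ℝ)) ∈ Z1 from ⟨_, htV, rfl⟩)
    simp at this; rw [this]; norm_num

/-- The reduced (topological) setting. -/
structure Setup (ε L : ℝ) (γ T : ℝ → E3) (F : ℝ × ℝ → E3) : Prop where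
  e0 : 0 < ε
  e1 : ε < 1 / 10000
  hL : 1 ≤ L
  der : ∀ s, HasDerivAt γ (T s) s
  nrm : ∀ s, ‖T s‖ = 1
  osc : ∀ s t : ℝ, |s - t| ≤ 1 → ‖T s - T t‖ ≤ ε
  Tper : ∀ s, T (s + L) = T s
  Fc : Continuous F
  Fper : ∀ s y, F (s + L, y) = F (s, y)
  Finj : ∀ p q : ℝ × ℝ, p.2 ∈ Icc (0:ℝ) 1 → q.2 ∈ Icc (0:ℝ) 1 → F p = F q →
    p.2 = q.2 ∧ ∃ m : ℤ, p.1 = q.1 + m * L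
  F0 : ∀ s, F (s, 0) = γ s
  area : μH[2] (annulusSet F) ≤ ENNReal.ofReal (ε ^ 2)

/-- a good base point together with a direction -/
structure Good (ε : ℝ) (γ T : ℝ → E3) (F : ℝ × ℝ → E3) (s : ℝ) (τ : E3) : Prop where
  nrm : ‖τ‖ = 1
  near : ∀ t, |t - s| ≤ 1 / 2 → ‖T t - τ‖ ≤ ε
  len : μH[1] (annulusSet F ∩ (fun z => inner ℝ τ z) ⁻¹' {inner ℝ τ (γ s)}) ≤ ENNReal.ofReal ε

/-- a compact connected subset of a slice through the base point -/
structure Arc (γ : ℝ → E3) (F : ℝ × ℝ → E3) (s : ℝ) (τ : E3) (K : Set (ℝ × ℝ)) : Prop where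
  cpt : IsCompact K
  con : IsPreconnected K
  str : ∀ p ∈ K, p.2 ∈ Icc (0:ℝ) 1
  mem : (s, (0:ℝ)) ∈ K
  sl : ∀ p ∈ K, inner ℝ τ (F p) = inner ℝ τ (γ s)

section
variable {ε L : ℝ} {γ T : ℝ → E3} {F : ℝ × ℝ → E3}

lemma near_line (hS : Setup ε L γ T F) (τ : E3) (a b : ℝ)
    (h : ∀ t ∈ uIcc a b, ‖T t - τ‖ ≤ ε) : ‖γ b - γ a - (b - a) • τ‖ ≤ ε * |b - a| := by
  have := (convex_uIcc a b).norm_image_sub_le_of_norm_hasDerivWithin_le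
    (f := fun t => γ t - t • τ) (f' := fun t => T t - τ) (C := ε)
    (fun t _ => by
      have h1 := (hS.der t).fun_sub ((hasDerivAt_id t).smul_const τ)
      rw [one_smul] at h1
      exact h1.hasDerivWithinAt) h
    left_mem_uIcc right_mem_uIcc
  rw [Real.norm_eq_abs] at this
  have h2 : γ b - γ a - (b - a) • τ = γ b - b • τ - (γ a - a • τ) := by
    rw [sub_smul]; abel
  rw [h2]; exact this

lemma abs_le_of_uIcc {a b t : ℝ} (h : t ∈ uIcc a b) : |t - a| ≤ |b - a| := by
  rcases mem_uIcc.1 h with h | h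
  · rw [abs_of_nonneg (by linarith), abs_of_nonneg (by linarith)]; linarith
  · rw [abs_of_nonpos (by linarith), abs_of_nonpos (by linarith)]; linarith

lemma chord (hS : Setup ε L γ T F) (a b : ℝ) (h : |b - a| ≤ 1) :
    (1 - ε) * |b - a| ≤ dist (γ b) (γ a) := by
  have h1 := near_line hS (T a) a b (fun t ht => hS.osc _ _ ((abs_le_of_uIcc ht).trans h))
  have h2 : ‖(b - a) • T a‖ = |b - a| := by rw [norm_smul, hS.nrm, Real.norm_eq_abs, mul_one]
  have h3 := norm_sub_norm_le ((b - a) • T a) (γ b - γ a)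
  rw [norm_sub_rev ((b - a) • T a), h2] at h3
  rw [dist_eq_norm]; linarith

lemma inner_bound {τ : E3} (hτ : ‖τ‖ = 1) (z : E3) (d e : ℝ) (h : ‖z - d • τ‖ ≤ e) :
    |inner ℝ τ z - d| ≤ e := by
  have h1 : inner ℝ τ z - d = inner ℝ τ (z - d • τ) := by
    rw [inner_sub_right, real_inner_smul_right, real_inner_self_eq_norm_sq, hτ]; ring
  rw [h1]
  have := abs_real_inner_le_norm τ (z - d • τ)
  rw [hτ, one_mul] at this
  exact this.trans h

lemma Good.height (hS : Setup ε L γ T F) {s : ℝ} {τ : E3} (hG : Good ε γ T F s τ) (t : ℝ)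
    (ht : |t - s| ≤ 1 / 2) : |inner ℝ τ (γ t) - inner ℝ τ (γ s) - (t - s)| ≤ ε * |t - s| := by
  rw [← inner_sub_right]
  exact inner_bound hG.nrm _ _ _
    (near_line hS τ s t fun x hx => hG.near x ((abs_le_of_uIcc hx).trans ht))

lemma Good.pos (hS : Setup ε L γ T F) {s : ℝ} {τ : E3} (hG : Good ε γ T F s τ) (t : ℝ)
    (h1 : s < t) (ht : t ≤ s + 1 / 2) : 0 < inner ℝ τ (γ t) - inner ℝ τ (γ s) := by
  have := hG.height hS t (by rw [abs_of_pos] <;> linarith)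
  rw [abs_of_pos (show 0 < t - s by linarith)] at this
  have h2 := (abs_le.1 this).1
  nlinarith [hS.e1]

lemma Good.neg (hS : Setup ε L γ T F) {s : ℝ} {τ : E3} (hG : Good ε γ T F s τ) (t : ℝ)
    (h1 : t < s) (ht : s - 1 / 2 ≤ t) : inner ℝ τ (γ t) - inner ℝ τ (γ s) < 0 := by
  have := hG.height hS t (by rw [abs_of_neg] <;> linarith)
  rw [abs_of_neg (show t - s < 0 by linarith)] at this
  have h2 := (abs_le.1 this).2
  nlinarith [hS.e1]

lemma lip_inner {τ : E3} (hτ : ‖τ‖ = 1) : LipschitzWith 1 (fun z : E3 => inner ℝ τ z) := by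
  refine LipschitzWith.of_dist_le_mul fun x y => ?_
  rw [Real.dist_eq, ← inner_sub_right, dist_eq_norm]
  have := abs_real_inner_le_norm τ (x - y)
  rw [hτ] at this; simpa using this

lemma exists_good (hS : Setup ε L γ T F) (a : ℝ) :
    ∃ s ∈ Icc a (a + 1 / 10), ∃ τ, Good ε γ T F s τ := by
  have e0 := hS.e0
  have e1 := hS.e1
  set g : E3 → ℝ := fun z => inner ℝ (T a) z with hg
  set I := Icc (g (γ a)) (g (γ (a + 1 / 10))) with hI
  have hlen : 1 / 20 ≤ g (γ (a + 1 / 10)) - g (γ a) := by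
    have h1 := inner_bound (hS.nrm a) _ _ _ (near_line hS (T a) a (a + 1 / 10)
      (fun t ht => hS.osc _ _ ((abs_le_of_uIcc ht).trans (by norm_num))))
    rw [inner_sub_right] at h1
    have h2 := (abs_le.1 h1).1
    norm_num at h2
    simp only [hg]
    norm_num
    linarith
  obtain ⟨c, hc, hcl⟩ : ∃ c ∈ I, μH[1] (annulusSet F ∩ g ⁻¹' {c}) ≤ ENNReal.ofReal ε := by
    by_contra! hcon
    have h1 := eilenberg (annulusSet F) g (lip_inner (hS.nrm a))
    have h2 : ENNReal.ofReal ε * volume I ≤ ∫⁻ c : ℝ, μH[1] (annulusSet F ∩ g ⁻¹' {c}) := by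
      rw [← setLIntegral_const]
      refine (setLIntegral_mono' measurableSet_Icc fun c hc => (hcon c hc).le).trans ?_
      exact setLIntegral_le_lintegral _ _
    have h3 := (h2.trans h1).trans hS.area
    rw [hI, Real.volume_Icc, ← ENNReal.ofReal_mul e0.le, ENNReal.ofReal_le_ofReal_iff (by positivity)]
      at h3
    nlinarith
  have hγ : Continuous γ := continuous_iff_continuousAt.2 fun s => (hS.der s).continuousAt
  have hgc : Continuous g := (lip_inner (hS.nrm a)).continuous
  obtain ⟨s, hs, hsc⟩ := intermediate_value_Icc (show a ≤ a + 1 / 10 by linarith)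
    (f := fun s => g (γ s)) (hgc.comp hγ).continuousOn hc
  refine ⟨s, hs, T a, hS.nrm a, fun t ht => hS.osc _ _ ?_, ?_⟩
  · rw [abs_le] at ht ⊢; constructor <;> linarith [hs.1, hs.2]
  · simp only at hsc
    rw [← hsc] at hcl; exact hcl

lemma Arc.near (hS : Setup ε L γ T F) {s : ℝ} {τ : E3} {K : Set (ℝ × ℝ)} (hG : Good ε γ T F s τ)
    (hK : Arc γ F s τ K) (p : ℝ × ℝ) (hp : p ∈ K) : dist (F p) (γ s) ≤ ε := by
  have h1 := dist_le_hausdorff (F '' K) (hK.con.image F hS.Fc.continuousOn) (F p) (F (s, 0))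
    ⟨p, hp, rfl⟩ ⟨_, hK.mem, rfl⟩
  have h2 : F '' K ⊆ annulusSet F ∩ (fun z => inner ℝ τ z) ⁻¹' {inner ℝ τ (γ s)} := by
    rintro _ ⟨q, hq, rfl⟩
    exact ⟨⟨q, ⟨mem_univ _, hK.str q hq⟩, rfl⟩, hK.sl q hq⟩
  have h3 := (h1.trans (measure_mono h2)).trans hG.len
  rwa [ENNReal.ofReal_le_ofReal_iff hS.e0.le, hS.F0] at h3

/-- Exit lemma for arcs. -/
lemma arc_exit (hS : Setup ε L γ T F) {s : ℝ} {τ : E3} (hG : Good ε γ T F s τ)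
    (K : Set (ℝ × ℝ)) (hK : IsCompact K)
    (hKc : IsPreconnected K) (hKs : ∀ p ∈ K, p.2 ∈ Icc (0:ℝ) 1) (a b : ℝ)
    (hat : a < s) (htb : s < b) (ha : (a, (0:ℝ)) ∈ K) (hb : (b, (0:ℝ)) ∈ K) :
    ∃ A, Arc γ F s τ A ∧ ((A ∩ K).Nonempty ∨ ∃ x ∈ Icc a b, x ≠ s ∧ (x, (0:ℝ)) ∈ A) := by
  obtain ⟨A, h1, h2, h3, h4, h5, h6⟩ := exit_lemma
    (fun p => inner ℝ τ (F p) - inner ℝ τ (γ s))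
    (((lip_inner hG.nrm).continuous.comp hS.Fc).sub continuous_const) K hK hKc hKs a s b hat htb
    ha hb (1 / 2) (by norm_num)
    (fun x hx1 hx2 => by simp only [hS.F0]; exact hG.neg hS x hx2 hx1)
    (fun x hx1 hx2 => by simp only [hS.F0]; exact hG.pos hS x hx1 hx2)
    (by simp [hS.F0])
  exact ⟨A, ⟨h1, h2, h3, h5, fun p hp => sub_eq_zero.1 (h4 p hp)⟩, h6⟩

lemma local_pair (hS : Setup ε L γ T F) {s s' : ℝ} {τ τ' : E3} {K K' : Set (ℝ × ℝ)}
    (hG : Good ε γ T F s τ) (hG' : Good ε γ T F s' τ') (hK : Arc γ F s τ K)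
    (hK' : Arc γ F s' τ' K') (hne : (K ∩ K').Nonempty) (h : |s' - s| ≤ 1) :
    |s' - s| ≤ 1 / 100 := by
  obtain ⟨p, hp, hp'⟩ := hne
  have h1 := hK.near hS hG p hp
  have h2 := hK'.near hS hG' p hp'
  have h3 := chord hS s s' h
  have h4 := dist_triangle_left (γ s') (γ s) (F p)
  nlinarith [hS.e0, hS.e1, abs_nonneg (s' - s)]

lemma local_ret (hS : Setup ε L γ T F) {s t : ℝ} {τ : E3} {K : Set (ℝ × ℝ)}
    (hG : Good ε γ T F s τ) (hK : Arc γ F s τ K) (ht : (t, (0:ℝ)) ∈ K) (h : |t - s| ≤ 1) :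
    t = s := by
  have h1 := hK.near hS hG _ ht
  rw [hS.F0] at h1
  have h3 := chord hS s t h
  have h4 : |t - s| ≤ 1 / 2 := by nlinarith [hS.e0, hS.e1, abs_nonneg (t - s)]
  have h5 := hK.sl _ ht
  rw [hS.F0] at h5
  rw [abs_le] at h4
  rcases lt_trichotomy t s with h6 | h6 | h6
  · have := hG.neg hS t h6 (by linarith); linarith
  · exact h6
  · have := hG.pos hS t h6 (by linarith); linarith

/-- No links, by induction on the size of the link. -/
lemma no_link_aux (hS : Setup ε L γ T F) (n : ℕ) :
    (∀ (s s' : ℝ) (τ τ' : E3) (K K' : Set (ℝ × ℝ)), Good ε γ T F s τ → Good ε γ T F s' τ' →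
      Arc γ F s τ K → Arc γ F s' τ' K' → (K ∩ K').Nonempty → |s' - s| ≤ 1 + n / 4 →
      |s' - s| ≤ 1 / 100) ∧
    (∀ (s t : ℝ) (τ : E3) (K : Set (ℝ × ℝ)), Good ε γ T F s τ → Arc γ F s τ K →
      (t, (0:ℝ)) ∈ K → |t - s| ≤ 1 + n / 4 → t = s) := by
  induction n with
  | zero =>
    refine ⟨fun s s' τ τ' K K' hG hG' hK hK' hne h => ?_, fun s t τ K hG hK ht h => ?_⟩
    · exact local_pair hS hG hG' hK hK' hne (by simpa using h)
    · exact local_ret hS hG hK ht (by simpa using h)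
  | succ n ih =>
    obtain ⟨ih1, ih2⟩ := ih
    have hn : (0:ℝ) ≤ n := Nat.cast_nonneg n
    have hpair : ∀ (s s' : ℝ) (τ τ' : E3) (K K' : Set (ℝ × ℝ)), Good ε γ T F s τ →
      Good ε γ T F s' τ' → Arc γ F s τ K → Arc γ F s' τ' K' → (K ∩ K').Nonempty → s ≤ s' →
      s' - s ≤ 1 + (n + 1) / 4 → s' - s ≤ 1 / 100 := by
      intro s s' τ τ' K K' hG hG' hK hK' hne hss h
      by_cases hsm : s' - s ≤ 1 + n / 4
      · have := ih1 s s' τ τ' K K' hG hG' hK hK' hne (by rwa [abs_of_nonneg (by linarith)])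
        rwa [abs_of_nonneg (by linarith)] at this
      exfalso
      push Not at hsm
      obtain ⟨i, hi, σ, hGi⟩ := exists_good hS (s + 3 / 10)
      have hi1 := hi.1
      have hi2 := hi.2
      obtain ⟨p, hp, hp'⟩ := hne
      obtain ⟨A, hA, h6⟩ := arc_exit hS hGi (K ∪ K') (hK.cpt.union hK'.cpt)
        (hK.con.union p hp hp' hK'.con)
        (fun q hq => hq.elim (hK.str q) (hK'.str q)) s s' (by linarith) (by linarith)
        (Or.inl hK.mem) (Or.inr hK'.mem)
      rcases h6 with ⟨q, hqA, hq | hq⟩ | ⟨x, hx, hxi, hxA⟩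
      · have := ih1 i s σ τ A K hGi hG hA hK ⟨q, hqA, hq⟩ (by rw [abs_le]; constructor <;> linarith)
        rw [abs_le] at this; linarith [this.1]
      · have := ih1 i s' σ τ' A K' hGi hG' hA hK' ⟨q, hqA, hq⟩
          (by rw [abs_le]; constructor <;> linarith)
        rw [abs_le] at this; linarith [this.2]
      · exact hxi (ih2 i x σ A hGi hA hxA (by
          rw [abs_le]; constructor <;> linarith [hx.1, hx.2]))
    refine ⟨fun s s' τ τ' K K' hG hG' hK hK' hne h => ?_, fun s t τ K hG hK ht h => ?_⟩
    · push_cast at h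
      rcases le_total s s' with hss | hss
      · rw [abs_of_nonneg (by linarith)] at h ⊢
        exact hpair s s' τ τ' K K' hG hG' hK hK' hne hss h
      · rw [abs_of_nonpos (by linarith)] at h ⊢
        rw [inter_comm] at hne
        have := hpair s' s τ' τ K' K hG' hG hK' hK hne hss (by linarith)
        linarith
    · push_cast at h
      by_contra hts
      have hbig : 1 + (n:ℝ) / 4 < |t - s| := by
        by_contra hc
        push Not at hc
        exact hts (ih2 s t τ K hG hK ht hc)
      rcases le_total s t with hst | hst
      · rw [abs_of_nonneg (by linarith)] at h hbig
        obtain ⟨i, hi, σ, hGi⟩ := exists_good hS (s + 3 / 10)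
        have hi1 := hi.1
        have hi2 := hi.2
        obtain ⟨A, hA, h6⟩ := arc_exit hS hGi K hK.cpt hK.con hK.str s t (by linarith) (by linarith)
          hK.mem ht
        rcases h6 with ⟨q, hqA, hq⟩ | ⟨x, hx, hxi, hxA⟩
        · have := ih1 i s σ τ A K hGi hG hA hK ⟨q, hqA, hq⟩
            (by rw [abs_le]; constructor <;> linarith)
          rw [abs_le] at this; linarith [this.1]
        · exact hxi (ih2 i x σ A hGi hA hxA (by
            rw [abs_le]; constructor <;> linarith [hx.1, hx.2]))
      · rw [abs_of_nonpos (by linarith)] at h hbig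
        obtain ⟨i, hi, σ, hGi⟩ := exists_good hS (s - 4 / 10)
        have hi1 := hi.1
        have hi2 := hi.2
        obtain ⟨A, hA, h6⟩ := arc_exit hS hGi K hK.cpt hK.con hK.str t s (by linarith) (by linarith)
          ht hK.mem
        rcases h6 with ⟨q, hqA, hq⟩ | ⟨x, hx, hxi, hxA⟩
        · have := ih1 i s σ τ A K hGi hG hA hK ⟨q, hqA, hq⟩
            (by rw [abs_le]; constructor <;> linarith)
          rw [abs_le] at this; linarith [this.2]
        · exact hxi (ih2 i x σ A hGi hA hxA (by
            rw [abs_le]; constructor <;> linarith [hx.1, hx.2]))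

lemma no_pair (hS : Setup ε L γ T F) {s s' : ℝ} {τ τ' : E3} {K K' : Set (ℝ × ℝ)}
    (hG : Good ε γ T F s τ) (hG' : Good ε γ T F s' τ') (hK : Arc γ F s τ K)
    (hK' : Arc γ F s' τ' K') (hne : (K ∩ K').Nonempty) : |s' - s| ≤ 1 / 100 := by
  obtain ⟨n, hn⟩ := exists_nat_ge (4 * |s' - s|)
  exact (no_link_aux hS n).1 s s' τ τ' K K' hG hG' hK hK' hne (by linarith)

lemma no_ret (hS : Setup ε L γ T F) {s t : ℝ} {τ : E3} {K : Set (ℝ × ℝ)}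
    (hG : Good ε γ T F s τ) (hK : Arc γ F s τ K) (ht : (t, (0:ℝ)) ∈ K) : t = s := by
  obtain ⟨n, hn⟩ := exists_nat_ge (4 * |t - s|)
  exact (no_link_aux hS n).2 s t τ K hG hK ht (by linarith)

lemma Setup.Fperm (hS : Setup ε L γ T F) (m : ℤ) (s y : ℝ) : F (s + m * L, y) = F (s, y) :=
  (show Function.Periodic (fun x => F (x, y)) L from fun x => hS.Fper x y).int_mul m s

lemma Setup.γperm (hS : Setup ε L γ T F) (m : ℤ) (s : ℝ) : γ (s + m * L) = γ s := by
  rw [← hS.F0, hS.Fperm, hS.F0]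

lemma Setup.Tperm (hS : Setup ε L γ T F) (m : ℤ) (s : ℝ) : T (s + m * L) = T s :=
  (show Function.Periodic T L from hS.Tper).int_mul m s

lemma Good.shift (hS : Setup ε L γ T F) {s : ℝ} {τ : E3} (hG : Good ε γ T F s τ) (m : ℤ) :
    Good ε γ T F (s + m * L) τ := by
  refine ⟨hG.nrm, fun t ht => ?_, ?_⟩
  · have h1 := hS.Tperm m (t - m * L)
    rw [sub_add_cancel] at h1
    rw [h1]
    exact hG.near _ (by rwa [show t - m * L - s = t - (s + m * L) by ring])
  · rw [hS.γperm]; exact hG.len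

lemma Arc.shift (hS : Setup ε L γ T F) {s : ℝ} {τ : E3} {K : Set (ℝ × ℝ)} (hK : Arc γ F s τ K)
    (m : ℤ) : Arc γ F (s + m * L) τ ((fun p : ℝ × ℝ => (p.1 + m * L, p.2)) '' K) := by
  have hc : Continuous (fun p : ℝ × ℝ => (p.1 + m * L, p.2)) := by fun_prop
  refine ⟨hK.cpt.image hc, hK.con.image _ hc.continuousOn, ?_, ⟨_, hK.mem, rfl⟩, ?_⟩
  · rintro _ ⟨p, hp, rfl⟩; exact hK.str p hp
  · rintro _ ⟨p, hp, rfl⟩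
    simp only
    rw [hS.Fperm, hS.γperm]; exact hK.sl p hp

/-- An arc does not wrap around indefinitely. -/
lemma wrap_count (hS : Setup ε L γ T F) {s : ℝ} {τ : E3} (hG : Good ε γ T F s τ) :
    ∃ η : ℝ, 0 < η ∧ ∀ (A : Set (ℝ × ℝ)) (J : Finset ℤ), Arc γ F s τ A →
      (∀ k ∈ J, (∃ p ∈ A, p.1 ≤ s + k * L) ∧ (∃ p ∈ A, s + k * L + L / 2 ≤ p.1)) →
      J.card * η ≤ ε := by
  have hL := hS.hL
  have hseg : ∀ x : ℝ, IsCompact (F '' ({x} ×ˢ Icc (0:ℝ) 1)) := fun x =>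
    (isCompact_singleton.prod isCompact_Icc).image hS.Fc
  set V0 := F '' ({s} ×ˢ Icc (0:ℝ) 1) with hV0
  set V1 := F '' ({s + L / 2} ×ˢ Icc (0:ℝ) 1) with hV1
  have hne0 : V0.Nonempty := ⟨F (s, 0), (s, 0), by simp, rfl⟩
  have hne1 : V1.Nonempty := ⟨F (s + L / 2, 0), (s + L / 2, 0), by simp, rfl⟩
  set ρ : E3 → ℝ := fun z => Metric.infDist z V0 with hρ
  have hρL : LipschitzWith 1 ρ := Metric.lipschitz_infDist_pt V0
  obtain ⟨z, hz, hzmin⟩ := (hseg (s + L / 2)).exists_isMinOn hne1 hρL.continuous.continuousOn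
  have hpos : 0 < ρ z := by
    refine ((hseg s).isClosed.notMem_iff_infDist_pos hne0).1 ?_
    rintro ⟨p, ⟨hp1, hp2⟩, hpz⟩
    obtain ⟨q, ⟨hq1, hq2⟩, rfl⟩ := hz
    obtain ⟨-, m, hm⟩ := hS.Finj p q hp2 hq2 hpz
    rw [mem_singleton_iff] at hp1 hq1
    rw [hp1, hq1] at hm
    have h1 : (2 * m + 1 : ℝ) * L = 0 := by linarith
    rcases mul_eq_zero.1 h1 with h | h
    · have : (2 * m + 1 : ℤ) = 0 := by exact_mod_cast h
      omega
    · linarith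
  refine ⟨ρ z, hpos, fun A J hA hJ => ?_⟩
  set W : ℤ → Set (ℝ × ℝ) := fun k => A ∩ (Icc (s + k * L) (s + k * L + L / 2) ×ˢ univ) with hW
  have hWc : ∀ k, IsCompact (F '' W k) := fun k =>
    (hA.cpt.inter_right (isClosed_Icc.prod isClosed_univ)).image hS.Fc
  have hleft : ∀ (k : ℤ) (p : ℝ × ℝ), p ∈ A → p.1 = s + k * L → ρ (F p) = 0 := by
    intro k p hp h
    have : F p ∈ V0 := by
      refine ⟨(s, p.2), ⟨rfl, hA.str p hp⟩, ?_⟩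
      rw [← hS.Fperm k, ← h]
    exact Metric.infDist_zero_of_mem this
  have hright : ∀ (k : ℤ) (p : ℝ × ℝ), p ∈ A → p.1 = s + k * L + L / 2 → ρ z ≤ ρ (F p) := by
    intro k p hp h
    refine hzmin ⟨(s + L / 2, p.2), ⟨rfl, hA.str p hp⟩, ?_⟩
    rw [← hS.Fperm k, show s + L / 2 + k * L = p.1 by rw [h]; ring]
  have hρF : Continuous fun p => ρ (F p) := hρL.continuous.comp hS.Fc
  have hlow : ∀ k ∈ J, ENNReal.ofReal (ρ z) ≤ μH[1] (F '' W k) := by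
    intro k hk
    obtain ⟨⟨p, hp, hpx⟩, ⟨q, hq, hqx⟩⟩ := hJ k hk
    have := le_hausdorff_of_values (F '' W k) ρ hρL 0 (ρ z) (fun c hc => ?_)
    · simpa using this
    by_contra hcon
    have hcon' : ∀ w ∈ W k, ρ (F w) ≠ c := fun w hw h => hcon ⟨F w, ⟨w, hw, rfl⟩, h⟩
    -- two closed sets
    set C1 : Set (ℝ × ℝ) := {w | w.1 ≤ s + k * L} ∪ ({w | w.1 ≤ s + k * L + L / 2} ∩ {w | ρ (F w) ≤ c})
    set C2 : Set (ℝ × ℝ) := {w | s + k * L + L / 2 ≤ w.1} ∪ ({w | s + k * L ≤ w.1} ∩ {w | c ≤ ρ (F w)})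
    have hC1 : IsClosed C1 := (isClosed_le continuous_fst continuous_const).union
      ((isClosed_le continuous_fst continuous_const).inter (isClosed_le hρF continuous_const))
    have hC2 : IsClosed C2 := (isClosed_le continuous_const continuous_fst).union
      ((isClosed_le continuous_const continuous_fst).inter (isClosed_le continuous_const hρF))
    have hcov : A ⊆ C1 ∪ C2 := by
      intro w hw
      rcases le_total w.1 (s + k * L) with h1 | h1
      · exact Or.inl (Or.inl h1)
      rcases le_total w.1 (s + k * L + L / 2) with h2 | h2
      · rcases le_total (ρ (F w)) c with h3 | h3
        · exact Or.inl (Or.inr ⟨h2, h3⟩)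
        · exact Or.inr (Or.inr ⟨h1, h3⟩)
      · exact Or.inr (Or.inl h2)
    obtain ⟨w, hw, hw1, hw2⟩ := isPreconnected_closed_iff.1 hA.con C1 C2 hC1 hC2 hcov
      ⟨p, hp, Or.inl hpx⟩ ⟨q, hq, Or.inl hqx⟩
    rcases hw1 with h1 | ⟨h1, h1'⟩ <;> rcases hw2 with h2 | ⟨h2, h2'⟩ <;>
      simp only [mem_ofPred_eq] at *
    · linarith
    · have := hleft k w hw (le_antisymm h1 h2); linarith [hc.1]
    · have := hright k w hw (le_antisymm h1 h2); linarith [hc.2]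
    · exact hcon' w ⟨hw, ⟨h2, h1⟩, trivial⟩ (le_antisymm h1' h2')
  have hdisj : (J : Set ℤ).PairwiseDisjoint fun k => F '' W k := by
    intro k _ k' _ hkk
    rw [Function.onFun, Set.disjoint_left]
    rintro _ ⟨p, hp, rfl⟩ ⟨q, hq, hqp⟩
    obtain ⟨h2, m, hm⟩ := hS.Finj q p (hA.str q hq.1) (hA.str p hp.1) hqp
    have hm0 : m ≠ 0 := by
      rintro rfl
      simp at hm
      have a1 := hp.2.1
      have a2 := hq.2.1
      rw [hm] at a2
      have b1 := a1.1.trans a2.2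
      have b2 := a2.1.trans a1.2
      rcases lt_or_gt_of_ne hkk with h | h
      · have : (k:ℝ) + 1 ≤ k' := by exact_mod_cast h
        nlinarith
      · have : (k':ℝ) + 1 ≤ k := by exact_mod_cast h
        nlinarith
    have h3 := no_pair hS hG (hG.shift hS m) hA (hA.shift hS m)
      ⟨q, hq.1, p, hp.1, Prod.ext hm.symm h2.symm⟩
    have h4 : (1:ℝ) ≤ |(m:ℝ)| := by exact_mod_cast Int.one_le_abs hm0
    rw [add_sub_cancel_left, abs_mul, abs_of_pos (by linarith : 0 < L)] at h3
    nlinarith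
  have h1 : ∑ k ∈ J, μH[1] (F '' W k) = μH[1] (⋃ k ∈ J, F '' W k) :=
    (measure_biUnion_finset hdisj fun k _ => (hWc k).isClosed.measurableSet).symm
  have h2 : μH[1] (⋃ k ∈ J, F '' W k) ≤ ENNReal.ofReal ε := by
    refine (measure_mono ?_).trans hG.len
    refine iUnion₂_subset fun k _ => ?_
    rintro _ ⟨p, hp, rfl⟩
    exact ⟨⟨p, ⟨mem_univ _, hA.str p hp.1⟩, rfl⟩, hA.sl p hp.1⟩
  have h3 : ENNReal.ofReal (J.card * ρ z) ≤ ENNReal.ofReal ε := by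
    refine le_trans ?_ (h1.le.trans h2)
    rw [ENNReal.ofReal_mul (by positivity), ENNReal.ofReal_natCast, ← nsmul_eq_mul]
    exact Finset.card_nsmul_le_sum J _ _ hlow
  rwa [ENNReal.ofReal_le_ofReal_iff hS.e0.le] at h3

lemma reach_top (hS : Setup ε L γ T F) {s : ℝ} {τ : E3} (hG : Good ε γ T F s τ) :
    ∃ A e, Arc γ F s τ A ∧ (e, (1:ℝ)) ∈ A := by
  by_contra hcon
  have hL := hS.hL
  obtain ⟨η, hη, hcount⟩ := wrap_count hS hG
  obtain ⟨n, hn⟩ := exists_nat_gt (ε / η)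
  rw [div_lt_iff₀ hη] at hn
  set a := s - (n + 1) * L with ha
  set b := s + (n + 1) * L with hb
  have hnL : 0 < (n + 1 : ℝ) * L := by positivity
  set U1 : Set (ℝ × ℝ) := {a} ×ˢ Icc (0:ℝ) 1 with hU1
  set U2 : Set (ℝ × ℝ) := Icc a b ×ˢ {(1:ℝ)} with hU2
  set U3 : Set (ℝ × ℝ) := {b} ×ˢ Icc (0:ℝ) 1 with hU3
  have hab : a ≤ b := by linarith
  obtain ⟨A, hA, h⟩ := arc_exit hS hG ((U1 ∪ U2) ∪ U3)
    (((isCompact_singleton.prod isCompact_Icc).union (isCompact_Icc.prod isCompact_singleton)).union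
      (isCompact_singleton.prod isCompact_Icc))
    (IsPreconnected.union (b, 1) (Or.inr ⟨⟨hab, le_rfl⟩, rfl⟩) ⟨rfl, by simp⟩
      (IsPreconnected.union (a, 1) ⟨rfl, by simp⟩ ⟨⟨le_rfl, hab⟩, rfl⟩
        (isPreconnected_singleton.prod isPreconnected_Icc)
        (isPreconnected_Icc.prod isPreconnected_singleton))
      (isPreconnected_singleton.prod isPreconnected_Icc))
    (by
      rintro p ((hp | hp) | hp)
      · exact hp.2
      · rw [hp.2]; simp
      · exact hp.2)
    a b (by linarith) (by linarith) (Or.inl (Or.inl ⟨rfl, by simp⟩)) (Or.inr ⟨rfl, by simp⟩)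
  rcases h with ⟨p, hpA, (hp | hp) | hp⟩ | ⟨x, -, hxs, hxA⟩
  · have hpa : p.1 = a := hp.1
    have := hcount A (Finset.Ico (-(n:ℤ)) 0) hA (fun k hk => ?_)
    · simp at this; linarith
    · rw [Finset.mem_Ico] at hk
      have hk1 : -(n:ℝ) ≤ k := by exact_mod_cast hk.1
      have hk2 : (k:ℝ) + 1 ≤ 0 := by exact_mod_cast hk.2
      exact ⟨⟨p, hpA, by rw [hpa, ha]; nlinarith⟩, ⟨_, hA.mem, by simp only; nlinarith⟩⟩
  · exact hcon ⟨A, p.1, hA, by rw [← show p.2 = 1 from hp.2]; exact hpA⟩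
  · have hpa : p.1 = b := hp.1
    have := hcount A (Finset.Ico 0 (n:ℤ)) hA (fun k hk => ?_)
    · simp at this; linarith
    · rw [Finset.mem_Ico] at hk
      have hk1 : (0:ℝ) ≤ k := by exact_mod_cast hk.1
      have hk2 : (k:ℝ) + 1 ≤ n := by exact_mod_cast hk.2
      exact ⟨⟨_, hA.mem, by simp only; nlinarith⟩, ⟨p, hpA, by rw [hpa, hb]; nlinarith⟩⟩
  · exact hxs (no_ret hS hG hA hxA)

lemma len_split (hS : Setup ε L γ T F) (e e' f : ℝ) (h1 : e ≤ e') (h2 : e' ≤ f) (h3 : f - L ≤ e) :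
    μH[1] (F '' (Icc e e' ×ˢ {1})) + μH[1] (F '' (Icc e' f ×ˢ {1})) ≤
      μH[1] (F '' (Icc e f ×ˢ {1})) := by
  have hL := hS.hL
  have hc : ∀ x y : ℝ, MeasurableSet (F '' (Icc x y ×ˢ {(1:ℝ)})) := fun x y =>
    ((isCompact_Icc.prod isCompact_singleton).image hS.Fc).isClosed.measurableSet
  rw [← measure_union_add_inter _ (hc e' f)]
  have hz : μH[1] (F '' (Icc e e' ×ˢ {1}) ∩ F '' (Icc e' f ×ˢ {1})) = 0 := by
    have : F '' (Icc e e' ×ˢ {1}) ∩ F '' (Icc e' f ×ˢ {1}) ⊆ {F (e', 1), F (f, 1)} := by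
      rintro _ ⟨⟨p, ⟨hp1, hp2⟩, rfl⟩, ⟨q, ⟨hq1, hq2⟩, hqp⟩⟩
      rw [mem_singleton_iff] at hp2 hq2
      obtain ⟨-, m, hm⟩ := hS.Finj q p (by rw [hq2]; simp) (by rw [hp2]; simp) hqp
      have hm0 : (0:ℝ) ≤ m := by
        by_contra hneg
        push Not at hneg
        nlinarith [hp1.2, hq1.1]
      have hm1 : (m:ℝ) ≤ 1 := by
        by_contra hneg
        push Not at hneg
        nlinarith [hp1.1, hq1.2]
      have hm0' : (0:ℤ) ≤ m := by exact_mod_cast hm0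
      have hm1' : m ≤ 1 := by exact_mod_cast hm1
      obtain rfl | rfl : m = 0 ∨ m = 1 := by omega
      · simp at hm
        left
        congr 1
        exact Prod.ext (le_antisymm hp1.2 (hm ▸ hq1.1)) hp2
      · simp at hm
        right
        rw [mem_singleton_iff, ← hqp]
        congr 1
        exact Prod.ext (le_antisymm hq1.2 (by simp only; linarith [hp1.1])) hq2
    have := Measure.nullSingletonClass_hausdorff E3 (d := 1) one_pos
    refine measure_mono_null ‹_› ?_
    exact (Set.toFinite _).countable.measure_zero _
  rw [hz, add_zero, ← image_union, ← union_prod, Icc_union_Icc_eq_Icc h1 h2]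

lemma piece (hS : Setup ε L γ T F) {s s' : ℝ} {τ τ' : E3} {K K' : Set (ℝ × ℝ)} {e e' : ℝ}
    (hG : Good ε γ T F s τ) (hG' : Good ε γ T F s' τ') (hK : Arc γ F s τ K)
    (hK' : Arc γ F s' τ' K') (he : (e, (1:ℝ)) ∈ K) (he' : (e', (1:ℝ)) ∈ K') (hee : e ≤ e')
    (hss : s ≤ s') (h1 : s' - s ≤ 1) :
    ENNReal.ofReal ((1 - ε) * (s' - s) - 2 * ε) ≤ μH[1] (F '' (Icc e e' ×ˢ {1})) := by
  have h2 := dist_le_hausdorff (F '' (Icc e e' ×ˢ {1}))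
    ((isPreconnected_Icc.prod isPreconnected_singleton).image F hS.Fc.continuousOn)
    (F (e', 1)) (F (e, 1)) ⟨(e', 1), ⟨⟨hee, le_rfl⟩, rfl⟩, rfl⟩ ⟨(e, 1), ⟨⟨le_rfl, hee⟩, rfl⟩, rfl⟩
  refine le_trans (ENNReal.ofReal_le_ofReal ?_) h2
  have h3 := hK.near hS hG _ he
  have h4 := hK'.near hS hG' _ he'
  have h5 := chord hS s s' (by rw [abs_of_nonneg] <;> linarith)
  rw [abs_of_nonneg (by linarith)] at h5
  have h6 := dist_triangle4 (γ s') (F (e', 1)) (F (e, 1)) (γ s)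
  rw [dist_comm (γ s') (F (e', 1))] at h6
  linarith

lemma chain (hS : Setup ε L γ T F) {sN eN : ℝ} {τN : E3} {KN : Set (ℝ × ℝ)}
    (hGN : Good ε γ T F sN τN) (hKN : Arc γ F sN τN KN) (heN : (eN, (1:ℝ)) ∈ KN) (n : ℕ) :
    ∀ (s e : ℝ) (τ : E3) (K : Set (ℝ × ℝ)), Good ε γ T F s τ → Arc γ F s τ K → (e, (1:ℝ)) ∈ K →
      eN - L ≤ e → e ≤ eN → s ≤ sN → sN - s ≤ 1 + n * (2 / 5) →
      ENNReal.ofReal ((1 - 10 * ε) * (sN - s) - 2 * ε) ≤ μH[1] (F '' (Icc e eN ×ˢ {1})) := by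
  have e0 := hS.e0
  have hbase : ∀ (s e : ℝ) (τ : E3) (K : Set (ℝ × ℝ)), Good ε γ T F s τ → Arc γ F s τ K →
      (e, (1:ℝ)) ∈ K → e ≤ eN → s ≤ sN → sN - s ≤ 1 →
      ENNReal.ofReal ((1 - 10 * ε) * (sN - s) - 2 * ε) ≤ μH[1] (F '' (Icc e eN ×ˢ {1})) := by
    intro s e τ K hG hK he h1 h2 h3
    refine le_trans (ENNReal.ofReal_le_ofReal ?_) (piece hS hG hGN hK hKN he heN h1 h2 h3)
    nlinarith
  induction n with
  | zero =>
    intro s e τ K hG hK he _ h1 h2 h3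
    exact hbase s e τ K hG hK he h1 h2 (by simpa using h3)
  | succ n ih =>
    intro s e τ K hG hK he h0 h1 h2 h3
    by_cases hsm : sN - s ≤ 1
    · exact hbase s e τ K hG hK he h1 h2 hsm
    push Not at hsm
    push_cast at h3
    obtain ⟨i, hi, σ, hGi⟩ := exists_good hS (s + 4 / 10)
    have hi1 := hi.1
    have hi2 := hi.2
    obtain ⟨A, hA, h⟩ := arc_exit hS hGi ((K ∪ Icc e eN ×ˢ {1}) ∪ KN)
      ((hK.cpt.union (isCompact_Icc.prod isCompact_singleton)).union hKN.cpt)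
      (IsPreconnected.union (eN, 1) (Or.inr ⟨⟨h1, le_rfl⟩, rfl⟩) heN
        (IsPreconnected.union (e, 1) he ⟨⟨le_rfl, h1⟩, rfl⟩ hK.con
          (isPreconnected_Icc.prod isPreconnected_singleton)) hKN.con)
      (by
        rintro p ((hp | hp) | hp)
        · exact hK.str p hp
        · rw [hp.2]; simp
        · exact hKN.str p hp)
      s sN (by linarith) (by linarith) (Or.inl (Or.inl hK.mem)) (Or.inr hKN.mem)
    rcases h with ⟨p, hpA, (hp | hp) | hp⟩ | ⟨x, -, hxs, hxA⟩
    · have := no_pair hS hG hGi hK hA ⟨p, hp, hpA⟩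
      rw [abs_le] at this; linarith [this.2]
    · have hp2 : p.2 = 1 := hp.2
      have hpe : (p.1, (1:ℝ)) ∈ A := by rw [← hp2]; exact hpA
      have hp1 := hp.1
      have hl := len_split hS e p.1 eN hp1.1 hp1.2 h0
      have hA1 := piece hS hG hGi hK hA he hpe hp1.1 (by linarith) (by linarith)
      have hA2 := ih i p.1 σ A hGi hA hpe (h0.trans hp1.1) hp1.2 (by linarith) (by linarith)
      refine le_trans ?_ ((add_le_add hA1 hA2).trans hl)
      refine le_trans ?_ ENNReal.ofReal_add_le
      refine ENNReal.ofReal_le_ofReal ?_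
      nlinarith
    · have := no_pair hS hGi hGN hA hKN ⟨p, hpA, hp⟩
      rw [abs_le] at this; linarith [this.2]
    · exact absurd (no_ret hS hGi hA hxA) hxs

lemma reduced (hS : Setup ε L γ T F) :
    ENNReal.ofReal ((1 - 12 * ε) * L) ≤ μH[1] (F '' (univ ×ˢ {1})) := by
  obtain ⟨s, -, τ, hG⟩ := exists_good hS 0
  obtain ⟨A, e, hA, he⟩ := reach_top hS hG
  have hG' := hG.shift hS 1
  have hA' := hA.shift hS 1
  have hL := hS.hL
  obtain ⟨n, hn⟩ := exists_nat_ge (5 * L)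
  have h1 := chain hS hG' hA' (eN := e + (1:ℤ) * L) ⟨_, he, rfl⟩ n s e τ A hG hA he (by simp)
    (by simp; linarith) (by simp; linarith) (by simp; linarith)
  refine le_trans (ENNReal.ofReal_le_ofReal ?_)
    (h1.trans (measure_mono (image_mono (prod_mono (subset_univ _) le_rfl))))
  simp
  nlinarith [hS.e0]

end

lemma toIco_ex {c : ℝ} (hc : 0 < c) (a : ℝ) : ∃ m : ℤ, a + m * c ∈ Ico (0:ℝ) c := by
  refine ⟨-toIcoDiv hc 0 a, ?_⟩
  have h1 := toIcoMod_mem_Ico hc 0 a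
  have h2 : toIcoMod hc 0 a = a + (-toIcoDiv hc 0 a : ℤ) * c := by
    simp [toIcoMod, sub_eq_add_neg]
  rw [← h2]
  simpa using h1

lemma per_int {X : Type*} {c : ℝ} {g : ℝ → X} (hp : Function.Periodic g c) (a : ℝ) (m : ℤ) :
    g (a + m * c) = g a := by
  simpa using hp.zsmul m a

lemma per_inj {X : Type*} {c : ℝ} (hc : 0 < c) {g : ℝ → X} (hp : Function.Periodic g c)
    (hi : InjOn g (Ico 0 c)) {a b : ℝ} (h : g a = g b) : ∃ m : ℤ, a = b + m * c := by
  obtain ⟨m, hm⟩ := toIco_ex hc a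
  obtain ⟨k, hk⟩ := toIco_ex hc b
  have := hi hm hk (by rw [per_int hp, per_int hp, h])
  refine ⟨k - m, ?_⟩
  push_cast
  linarith

lemma strip_inj {f : ℝ × ℝ → E3} (hp : ∀ x y : ℝ, f (x + 1, y) = f (x, y))
    (hi : InjOn f (Ico (0 : ℝ) 1 ×ˢ Icc (0 : ℝ) 1)) (p q : ℝ × ℝ)
    (hp2 : p.2 ∈ Icc (0:ℝ) 1) (hq2 : q.2 ∈ Icc (0:ℝ) 1) (h : f p = f q) :
    p.2 = q.2 ∧ ∃ m : ℤ, p.1 = q.1 + m := by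
  obtain ⟨m, hm⟩ := toIco_ex one_pos p.1
  obtain ⟨k, hk⟩ := toIco_ex one_pos q.1
  have hP : ∀ y, Function.Periodic (fun x => f (x, y)) 1 := fun y x => hp x y
  have e1 := per_int (hP p.2) p.1 m
  have e2 := per_int (hP q.2) q.1 k
  have := hi (x₁ := (p.1 + m * 1, p.2)) (x₂ := (q.1 + k * 1, q.2)) ⟨hm, hp2⟩ ⟨hk, hq2⟩
    (e1.trans (h.trans e2.symm))
  rw [Prod.mk.injEq] at this
  refine ⟨this.2, k - m, ?_⟩
  push_cast
  linarith [this.1]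

lemma exists_lift {c γ : ℝ → E3} (hc : Continuous c) (hp : Function.Periodic c 1)
    (hi : InjOn c (Ico 0 1)) (hγ : Continuous γ) (hr : ∀ s, ∃ x, c x = γ s) :
    ∃ φ : ℝ → ℝ, Continuous φ ∧ ∀ s, c (φ s) = γ s := by
  have : Fact ((0:ℝ) < 1) := ⟨one_pos⟩
  let ch : AddCircle (1:ℝ) → E3 := hp.lift
  have hch : Continuous ch := continuous_coinduced_dom.mpr hc
  have hinj : Function.Injective ch := by
    intro a b
    induction a using QuotientAddGroup.induction_on with | _ a => ?_
    induction b using QuotientAddGroup.induction_on with | _ b => ?_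
    intro h
    obtain ⟨m, hm⟩ := per_inj one_pos hp hi (a := a) (b := b) h
    refine (QuotientAddGroup.eq).2 ?_
    rw [AddSubgroup.mem_zmultiples_iff]
    exact ⟨-m, by simp [hm]⟩
  have hemb := hch.isClosedEmbedding hinj
  choose x hx using hr
  have hcont : Continuous (fun s => ((x s : ℝ) : AddCircle (1:ℝ))) := by
    rw [hemb.isInducing.continuous_iff]
    have : ch ∘ (fun s => ((x s : ℝ) : AddCircle (1:ℝ))) = γ := by
      funext s; exact hx s
    rw [this]; exact hγ
  obtain ⟨φ, ⟨-, h⟩, -⟩ := (AddCircle.isCoveringMap_coe (1:ℝ)).existsUnique_continuousMap_lifts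
    (⟨_, hcont⟩ : C(ℝ, AddCircle (1:ℝ))) 0 (x 0) rfl
  refine ⟨φ, φ.continuous, fun s => ?_⟩
  have := congrArg ch (congrFun h s)
  exact this.trans (hx s)

/-- **Theorem 1.1.** There is a universal constant `C > 0` such that: for `0 < ε < 1/10000`,
if `Γ₀ = range γ₀` and `Γ₁ = range γ₁` are disjoint connected closed embedded curves in `ℝ³`,
with `γ₀` an arc-length parametrization of period `L = Length(Γ₀) ≥ 1` whose unit tangent `T`
satisfies `|T(x) − T(y)| ≤ ε` whenever the intrinsic distance is `≤ 1`, and `Γ₀ ⊔ Γ₁ = ∂Σ` for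
a smoothly embedded compact annulus `Σ` (image of a smooth periodic embedding `f` of
`ℝ × [0,1]`) with `Area(Σ) ≤ ε²`, then `Length(Γ₁) ≥ (1 − Cε)·Length(Γ₀)`. -/
theorem stmt_0 :
    ∃ C : ℝ, 0 < C ∧
      ∀ (ε L : ℝ) (γ₀ T γ₁ : ℝ → E3) (f : ℝ × ℝ → E3),
        0 < ε → ε < 1 / 10000 →
        -- Γ₀ : connected closed embedded C¹ curve, arc-length parametrized, length L ≥ 1
        1 ≤ L →
        Function.Periodic γ₀ L →
        Set.InjOn γ₀ (Set.Ico 0 L) →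
        (∀ s, HasDerivAt γ₀ (T s) s) →
        (∀ s, ‖T s‖ = 1) →
        -- (i) the unit tangent varies by at most ε on sub-segments of length ≤ 1
        (∀ s t : ℝ, |s - t| ≤ 1 → ‖T s - T t‖ ≤ ε) →
        -- Γ₁ : a connected closed embedded curve disjoint from Γ₀
        Continuous γ₁ →
        Function.Periodic γ₁ 1 →
        Set.InjOn γ₁ (Set.Ico 0 1) →
        Disjoint (Set.range γ₀) (Set.range γ₁) →
        -- (iii) Σ : smoothly embedded compact annulus with ∂Σ = Γ₀ ⊔ Γ₁
        ContDiff ℝ (⊤ : ℕ∞) f →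
        (∀ x y : ℝ, f (x + 1, y) = f (x, y)) →
        Set.InjOn f (Set.Ico (0 : ℝ) 1 ×ˢ Set.Icc (0 : ℝ) 1) →
        (∀ p : ℝ × ℝ, p.2 ∈ Set.Icc (0 : ℝ) 1 → Function.Injective (fderiv ℝ f p)) →
        f '' (Set.univ ×ˢ ({0} : Set ℝ)) = Set.range γ₀ →
        f '' (Set.univ ×ˢ ({1} : Set ℝ)) = Set.range γ₁ →
        -- Area(Σ) ≤ ε²
        μH[2] (annulusSet f) ≤ ENNReal.ofReal (ε ^ 2) →
        -- conclusion : Length(Γ₁) ≥ (1 − Cε)·Length(Γ₀)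
        ENNReal.ofReal ((1 - C * ε) * L) ≤ μH[1] (Set.range γ₁) := by
  refine ⟨12, by norm_num, ?_⟩
  intro ε L γ₀ T γ₁ f he0 he1 hL hper hinj hder hnrm hosc _ _ _ _ hf hfper hfinj _ hf0 hf1 harea
  have hL0 : 0 < L := by linarith
  have hγc : Continuous γ₀ := continuous_iff_continuousAt.2 fun s => (hder s).continuousAt
  obtain ⟨φ, hφ, hφγ⟩ := exists_lift (c := fun x => f (x, 0)) (γ := γ₀)
    (hf.continuous.comp (by fun_prop)) (fun x => hfper x 0)
    (fun a ha b hb h => by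
      have := hfinj (x₁ := (a, 0)) (x₂ := (b, 0)) ⟨ha, by simp⟩ ⟨hb, by simp⟩ h
      exact (Prod.mk.inj this).1) hγc
    (fun s => by
      have : γ₀ s ∈ f '' (univ ×ˢ ({0} : Set ℝ)) := hf0 ▸ mem_range_self s
      obtain ⟨⟨x, y⟩, ⟨-, hy⟩, h⟩ := this
      obtain rfl : y = 0 := hy
      exact ⟨x, h⟩)
  have hP : ∀ y, Function.Periodic (fun x => f (x, y)) 1 := fun y x => hfper x y
  have hS : Setup ε L γ₀ T (fun p => f (φ p.1, p.2)) := by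
    refine ⟨he0, he1, hL, hder, hnrm, hosc, ?_, ?_, ?_, ?_, hφγ, ?_⟩
    · intro s
      have h1 := (hder (s + L)).comp_add_const s L
      have h2 : (fun x => γ₀ (x + L)) = γ₀ := funext hper
      rw [h2] at h1
      exact h1.unique (hder s)
    · exact hf.continuous.comp (by fun_prop)
    · intro s y
      have h1 : f (φ (s + L), 0) = f (φ s, 0) := by
        have a := hφγ (s + L)
        have b := hφγ s
        rw [hper s] at a
        exact a.trans b.symm
      obtain ⟨-, m, hm⟩ := strip_inj hfper hfinj _ _ (by simp) (by simp) h1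
      have := per_int (hP y) (φ s) m
      simp only [mul_one] at this
      simp only at hm ⊢
      rw [hm, this]
    · intro p q hp hq h
      obtain ⟨h1, m, hm⟩ := strip_inj hfper hfinj (φ p.1, p.2) (φ q.1, q.2) hp hq h
      refine ⟨h1, per_inj hL0 hper hinj ?_⟩
      have := per_int (hP 0) (φ q.1) m
      simp only [mul_one] at this hm
      rw [← hφγ, ← hφγ]
      rw [hm, this]
    · refine (measure_mono ?_).trans harea
      rintro _ ⟨p, hp, rfl⟩
      exact ⟨(φ p.1, p.2), ⟨mem_univ _, hp.2⟩, rfl⟩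
  refine (reduced hS).trans (measure_mono ?_)
  rw [← hf1]
  rintro _ ⟨p, hp, rfl⟩
  exact ⟨(φ p.1, p.2), ⟨mem_univ _, hp.2⟩, rfl⟩
end
end

section
/- The collection 𝒮 is empty: there is no compact sub-segment Γ ⊂ Γ₀ for which there exists a piecewise smooth embedded curve α ⊂ Σ such that (i) α has the same endpoints as Γ, (ii) α ∪ Γ bounds a topological disk in Σ, (iii) Length(α) ≤ 2ε, and (iv) Length(Γ) ≥ 1 and Length(Γ₀ ∖ Γ) ≥ 1. -/
open MeasureTheory Set

noncomputable section

/-- A piecewise-smooth curve on `[0,1]`: smooth on each interval of a finite partition. -/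
def PiecewiseSmooth (c : ℝ → E3) : Prop :=
  ∃ (n : ℕ) (t : Fin (n + 1) → ℝ), StrictMono t ∧ t 0 = 0 ∧ t (Fin.last n) = 1 ∧
    ∀ i : Fin n, ContDiffOn ℝ (⊤ : ℕ∞) c (Set.Icc (t i.castSucc) (t i.succ))



lemma sep_aux {X : Type*} [TopologicalSpace X] [T2Space X] [CompactSpace X] (K Z : Set X)
    (hK : IsClosed K) (hZ : IsClosed Z) (hZK : Z ⊆ K) (x₀ : X) (hx : x₀ ∈ K)
    (hd : Disjoint Z (connectedComponentIn K x₀)) :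
    ∃ U₁ U₂ : Set X, IsOpen U₁ ∧ IsOpen U₂ ∧ Disjoint U₁ U₂ ∧ K ⊆ U₁ ∪ U₂ ∧ x₀ ∈ U₁ ∧ Z ⊆ U₂ := by
  have : CompactSpace K := isCompact_iff_compactSpace.1 hK.isCompact
  let y₀ : K := ⟨x₀, hx⟩
  let Z' : Set K := Subtype.val ⁻¹' Z
  have hZ' : IsCompact Z' := (hZ.preimage continuous_subtype_val).isCompact
  have hcov : Z' ⊆ ⋃ s : { s : Set K // IsClopen s ∧ y₀ ∈ s }, (s : Set K)ᶜ := by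
    intro z hz
    by_contra hcon
    simp only [mem_iUnion, mem_compl_iff, not_exists, not_not] at hcon
    have : z ∈ connectedComponent y₀ := by
      rw [connectedComponent_eq_iInter_isClopen]
      exact mem_iInter.2 hcon
    refine Set.disjoint_left.1 hd hz ?_
    rw [connectedComponentIn_eq_image hx]
    exact ⟨z, this, rfl⟩
  obtain ⟨t, ht⟩ := hZ'.elim_finite_subcover _ (fun s => s.2.1.1.isOpen_compl) hcov
  let V : Set K := ⋂ s ∈ t, (s : Set K)
  have hV : IsClopen V := isClopen_biInter_finset (fun s _ => s.2.1)
  have hy : y₀ ∈ V := mem_iInter₂.2 fun s _ => s.2.2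
  have hVZ : Disjoint V Z' := by
    rw [Set.disjoint_left]
    intro v hv hz
    obtain ⟨s, hs, hvs⟩ := mem_iUnion₂.1 (ht hz)
    exact hvs (mem_iInter₂.1 hv s hs)
  have h1 : IsCompact (Subtype.val '' V : Set X) := hV.1.isCompact.image continuous_subtype_val
  have h2 : IsCompact (Subtype.val '' Vᶜ : Set X) :=
    hV.compl.1.isCompact.image continuous_subtype_val
  have hdis : Disjoint (Subtype.val '' V : Set X) (Subtype.val '' Vᶜ) :=
    (Set.disjoint_image_iff Subtype.val_injective).2 disjoint_compl_right
  obtain ⟨U₁, U₂, o1, o2, s1, s2, d⟩ := SeparatedNhds.of_isCompact_isCompact h1 h2 hdis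
  refine ⟨U₁, U₂, o1, o2, d, ?_, s1 ⟨y₀, hy, rfl⟩, ?_⟩
  · intro k hk
    by_cases h : (⟨k, hk⟩ : K) ∈ V
    · exact Or.inl (s1 ⟨_, h, rfl⟩)
    · exact Or.inr (s2 ⟨_, h, rfl⟩)
  · intro z hz
    exact s2 ⟨⟨z, hZK hz⟩, fun h => Set.disjoint_left.1 hVZ h hz, rfl⟩

/-- functions with integer multiples values on preconnected sets are constant -/
lemma int_const {X : Type*} [TopologicalSpace X] {S : Set X} (hS : IsPreconnected S)
    {g : X → ℝ} (hg : ContinuousOn g S) (hi : ∀ x ∈ S, ∃ n : ℤ, g x = n) {x y : X}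
    (hx : x ∈ S) (hy : y ∈ S) : g x = g y := by
  have hd : IsDiscrete (range ((↑) : ℤ → ℝ)) := by
    have := Int.isClosedEmbedding_coe_real.isEmbedding
    exact this.isDiscrete_range
  obtain ⟨c, -, hc⟩ := hS.eqOn_const_of_mapsTo hd hg
    (fun x hx => by obtain ⟨n, hn⟩ := hi x hx; exact ⟨n, hn.symm⟩) ⟨0, ⟨0, by simp⟩⟩
  exact (hc hx).trans (hc hy).symm

def cl (r : ℝ) : ℝ := max 0 (min 1 ((r + 1) / 2))

lemma cl_cont : Continuous cl := by unfold cl; fun_prop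
lemma cl_ge {r : ℝ} (h : 1 ≤ r) : cl r = 1 := by
  unfold cl; rw [min_eq_left (by linarith)]; norm_num
lemma cl_le {r : ℝ} (h : r ≤ -1) : cl r = 0 := by
  unfold cl; apply max_eq_left; exact (min_le_right _ _).trans (by linarith)

def ee (r : ℝ) : Circle := Circle.exp (r * (2 * Real.pi))

lemma ee_cont : Continuous ee := by unfold ee; fun_prop
lemma ee_eq {r s : ℝ} (h : ee r = ee s) : ∃ n : ℤ, r - s = n := by
  unfold ee at h
  obtain ⟨m, hm⟩ := Circle.exp_eq_exp.1 h
  refine ⟨m, ?_⟩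
  have := Real.pi_pos
  have h2 : (r - s - m) * (2 * Real.pi) = 0 := by linarith
  rcases mul_eq_zero.1 h2 with h | h <;> linarith
lemma ee_zero : ee 0 = 1 := by simp [ee]
lemma ee_one : ee 1 = 1 := by simp [ee]
lemma ee_cl {r : ℝ} (h : 1 ≤ |r|) : ee (cl r) = 1 := by
  rcases le_abs.1 h with h | h
  · rw [cl_ge h, ee_one]
  · rw [cl_le (by linarith), ee_zero]

lemma lower_aux {X : Type*} [TopologicalSpace X] {Q : Set X} (hQ : IsCompact Q) {φ : X → ℝ}
    (hφ : ContinuousOn φ Q) (h0 : ∀ x ∈ Q, φ x ≠ 0) : ∃ δ > 0, ∀ x ∈ Q, δ < |φ x| := by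
  rcases Q.eq_empty_or_nonempty with rfl | hne
  · exact ⟨1, one_pos, by simp⟩
  obtain ⟨x, hx, hm⟩ := hQ.exists_isMinOn hne hφ.abs
  have := abs_pos.2 (h0 x hx)
  exact ⟨|φ x| / 2, by linarith, fun y hy => by have := hm hy; simp at this; linarith⟩

lemma topo {X : Type*} [TopologicalSpace X] [T2Space X] [CompactSpace X]
    (hlift : ∀ u : C(X, Circle), ∃ h : C(X, ℝ), ∀ x, ee (h x) = u x)
    (φ : X → ℝ) (hφ : Continuous φ) (p : ℝ → X) (a a' m b : ℝ) (hp : ContinuousOn p (Icc a b))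
    (h1 : a < a') (h2 : a' < m) (h3 : m ≤ b)
    (hneg : ∀ s ∈ Ico a a', φ (p s) < 0) (hpos : ∀ s ∈ Ioc a' m, 0 < φ (p s))
    (hzero : φ (p a') = 0) (A : Set X) (hA : IsPreconnected A) (haA : p a ∈ A) (hbA : p b ∈ A)
    (c : ℝ) (hc : 0 < c) (hAc : ∀ x ∈ A, φ x ≤ -c) :
    ∃ b' ∈ Icc a b, b' ≠ a' ∧ p b' ∈ connectedComponentIn {x | φ x = 0} (p a') := by
  by_contra! hcon
  let K : Set X := {x | φ x = 0}
  have hK : IsClosed K := isClosed_eq hφ continuous_const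
  have hpm : ContinuousOn p (Icc m b) := hp.mono (Icc_subset_Icc (by linarith) le_rfl)
  have hpa : ContinuousOn p (Icc a m) := hp.mono (Icc_subset_Icc le_rfl h3)
  let Z : Set X := p '' Icc m b ∩ K
  have hZ : IsClosed Z := (isCompact_Icc.image_of_continuousOn hpm).isClosed.inter hK
  obtain ⟨U₁, U₂, o1, o2, hdis, hcov, hx1, hZ2⟩ := sep_aux K Z hK hZ inter_subset_right (p a') hzero (by
    rw [Set.disjoint_left]
    rintro _ ⟨⟨s, hs, rfl⟩, -⟩
    exact hcon s ⟨by linarith [hs.1], hs.2⟩ (by linarith [hs.1]))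
  -- lower bounds
  obtain ⟨δ₁, d1, hδ₁⟩ := lower_aux (Q := (U₁ ∪ U₂)ᶜ) (o1.union o2).isClosed_compl.isCompact
    hφ.continuousOn (fun x hx h => hx (hcov h))
  obtain ⟨δ₂, d2, hδ₂⟩ := lower_aux (Q := p '' Icc m b ∩ U₂ᶜ)
    ((isCompact_Icc.image_of_continuousOn hpm).inter_right o2.isClosed_compl)
    hφ.continuousOn (fun x hx h => hx.2 (hZ2 ⟨hx.1, h⟩))
  obtain ⟨δ₃, d3, hδ₃⟩ := lower_aux (Q := p '' Icc a m ∩ U₁ᶜ)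
    ((isCompact_Icc.image_of_continuousOn hpa).inter_right o1.isClosed_compl)
    hφ.continuousOn (by
      rintro _ ⟨⟨s, hs, rfl⟩, hx⟩ h
      rcases lt_trichotomy s a' with h' | h' | h'
      · exact (hneg s ⟨hs.1, h'⟩).ne h
      · exact hx (h' ▸ hx1)
      · exact (hpos s ⟨h', hs.2⟩).ne' h)
  have d4 := hpos m ⟨h2, le_rfl⟩
  obtain ⟨δ, hδ, e1, e2, e3, e4, e5⟩ : ∃ δ > 0, δ ≤ δ₁ ∧ δ ≤ δ₂ ∧ δ ≤ δ₃ ∧ δ ≤ φ (p m) ∧ δ ≤ c :=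
    ⟨min δ₁ (min δ₂ (min δ₃ (min (φ (p m)) c))), by positivity, by simp, by simp, by simp, by simp, by simp⟩
  have key : ∀ r : ℝ, δ ≤ |r| → ee (cl (r / δ)) = 1 := fun r hr => ee_cl (by
    rw [abs_div, abs_of_pos hδ, le_div_iff₀ hδ]; linarith)
  classical
  let u : X → Circle := fun x => if x ∈ U₁ then ee (cl (φ x / δ)) else 1
  have hu1 : ∀ x ∈ U₁, u x = ee (cl (φ x / δ)) := fun x hx => if_pos hx
  have hu2 : ∀ x ∉ U₁, u x = 1 := fun x hx => if_neg hx
  have huδ : ∀ x, δ ≤ |φ x| → u x = 1 := by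
    intro x hx
    by_cases h : x ∈ U₁
    · rw [hu1 x h, key _ hx]
    · exact hu2 x h
  have hucont : Continuous u := by
    rw [continuous_iff_continuousAt]
    intro x
    by_cases hx : x ∈ U₁
    · have : ContinuousAt (fun x => ee (cl (φ x / δ))) x :=
        (ee_cont.comp (cl_cont.comp (hφ.div_const δ))).continuousAt
      refine this.congr ?_
      filter_upwards [o1.mem_nhds hx] with y hy using (hu1 y hy).symm
    · refine (continuousAt_const (y := (1 : Circle))).congr ?_
      by_cases hx2 : x ∈ U₂
      · filter_upwards [o2.mem_nhds hx2] with y hy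
        exact (hu2 y (fun h => Set.disjoint_left.1 hdis h hy)).symm
      · have : δ < |φ x| := lt_of_le_of_lt e1 (hδ₁ x (by simp [hx, hx2]))
        filter_upwards [(isOpen_lt continuous_const hφ.abs).mem_nhds this] with y hy
        exact (huδ y (le_of_lt hy)).symm
  obtain ⟨h, hh⟩ := hlift ⟨u, hucont⟩
  simp only [ContinuousMap.coe_mk] at hh
  have int1 : ∀ x, u x = 1 → ∃ n : ℤ, h x = n := by
    intro x hx
    have := hh x
    rw [hx, ← ee_zero] at this
    simpa using ee_eq this
  have c1 : h (p a) = h (p b) := int_const hA h.continuous.continuousOn (fun x hx => int1 x (huδ x (by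
    rw [abs_of_nonpos (by linarith [hAc x hx])]; linarith [hAc x hx]))) haA hbA
  have c2 : h (p m) = h (p b) := by
    refine int_const (g := fun s => h (p s)) (S := Icc m b) isPreconnected_Icc
      (h.continuous.comp_continuousOn hpm) ?_ ⟨le_rfl, h3⟩ ⟨h3, le_rfl⟩
    intro s hs
    apply int1
    by_cases hU : p s ∈ U₂
    · exact hu2 _ (fun h => Set.disjoint_left.1 hdis h hU)
    · exact huδ _ (e2.trans (hδ₂ _ ⟨⟨s, hs, rfl⟩, hU⟩).le)
  have c3 : h (p a) - cl (φ (p a) / δ) = h (p m) - cl (φ (p m) / δ) := by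
    refine int_const (g := fun s => h (p s) - cl (φ (p s) / δ)) (S := Icc a m) isPreconnected_Icc
      ?_ ?_ ⟨le_rfl, by linarith⟩ ⟨by linarith, le_rfl⟩
    · exact (h.continuous.comp_continuousOn hpa).sub
        ((cl_cont.comp (hφ.div_const δ)).comp_continuousOn hpa)
    · intro s hs
      apply ee_eq
      rw [hh]
      by_cases hU : p s ∈ U₁
      · exact hu1 _ hU
      · rw [hu2 _ hU, key _ (e3.trans (hδ₃ _ ⟨⟨s, hs, rfl⟩, hU⟩).le)]
  rw [cl_le (by rw [div_le_iff₀ hδ]; linarith [hAc _ haA]),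
    cl_ge (by rw [le_div_iff₀ hδ]; linarith)] at c3
  linarith

lemma ball_lift (u : C(Metric.closedBall (0 : EuclideanSpace ℝ (Fin 2)) 1, Circle)) :
    ∃ h : C(Metric.closedBall (0 : EuclideanSpace ℝ (Fin 2)) 1, ℝ), ∀ x, ee (h x) = u x := by
  let r : C(EuclideanSpace ℝ (Fin 2), Metric.closedBall (0 : EuclideanSpace ℝ (Fin 2)) 1) :=
    ⟨fun x => ⟨(max 1 ‖x‖)⁻¹ • x, by
      rw [mem_closedBall_zero_iff, norm_smul, norm_inv, Real.norm_of_nonneg (by positivity),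
        inv_mul_le_iff₀ (by positivity)]
      simp⟩, by
      refine Continuous.subtype_mk (Continuous.smul (Continuous.inv₀ (continuous_const.max continuous_norm) ?_) continuous_id) _
      intro x; positivity⟩
  have hr : ∀ x : Metric.closedBall (0 : EuclideanSpace ℝ (Fin 2)) 1, r x = x := by
    intro x
    apply Subtype.ext
    have := mem_closedBall_zero_iff.1 x.2
    simp [r, max_eq_left this]
  obtain ⟨e₀, he₀⟩ := Circle.exp_surjective ((u.comp r) 0)
  obtain ⟨H, ⟨-, hH⟩, -⟩ := Circle.isCoveringMap_exp.existsUnique_continuousMap_lifts (u.comp r) 0 e₀ he₀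
  refine ⟨⟨fun x => H x / (2 * Real.pi), by fun_prop⟩, fun x => ?_⟩
  have := congrFun hH x
  simp only [Function.comp, ContinuousMap.comp_apply, hr] at this
  have h0 := Real.pi_pos.ne'
  simp only [ee, ContinuousMap.coe_mk]
  rw [div_mul_cancel₀ _ (by positivity)]
  exact this


lemma dist_le_of_cover {S : Set E3} (hS : IsPreconnected S) {ι : Type*} [Countable ι] (t : ι → Set E3)
    (hc : S ⊆ ⋃ i, t i) (d : ℝ) (hd : 0 ≤ d) (hsum : ∑' i, Metric.ediam (t i) ≤ ENNReal.ofReal d)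
    {x y : E3} (hx : x ∈ S) (hy : y ∈ S) : dist x y ≤ d := by
  have hlip : LipschitzWith 1 (fun z : E3 => dist x z) := LipschitzWith.dist_right x
  have hpre : IsPreconnected ((fun z : E3 => dist x z) '' S) := hS.image _ hlip.continuous.continuousOn
  have hsub : Icc 0 (dist x y) ⊆ (fun z : E3 => dist x z) '' S :=
    hpre.Icc_subset ⟨x, hx, by simp⟩ ⟨y, hy, rfl⟩
  have : volume (Icc 0 (dist x y)) ≤ ENNReal.ofReal d := by
    calc volume (Icc 0 (dist x y)) ≤ volume (⋃ i, (fun z : E3 => dist x z) '' t i) := by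
          apply measure_mono
          rw [← image_iUnion]
          exact hsub.trans (image_mono hc)
      _ ≤ ∑' i, volume ((fun z : E3 => dist x z) '' t i) := measure_iUnion_le _
      _ ≤ ∑' i, Metric.ediam (t i) := by
          refine ENNReal.tsum_le_tsum fun i => ?_
          refine (Real.volume_le_diam _).trans ?_
          simpa using hlip.ediam_image_le (t i)
      _ ≤ _ := hsum
  rw [Real.volume_Icc, sub_zero] at this
  exact (ENNReal.ofReal_le_ofReal_iff hd).1 this

lemma dist_le_of_H1 {S : Set E3} (hS : IsPreconnected S) (d : ℝ) (hd : 0 ≤ d)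
    (hsum : μH[1] S ≤ ENNReal.ofReal d)
    {x y : E3} (hx : x ∈ S) (hy : y ∈ S) : dist x y ≤ d := by
  have hlip : LipschitzWith 1 (fun z : E3 => dist x z) := LipschitzWith.dist_right x
  have hpre : IsPreconnected ((fun z : E3 => dist x z) '' S) := hS.image _ hlip.continuous.continuousOn
  have hsub : Icc 0 (dist x y) ⊆ (fun z : E3 => dist x z) '' S :=
    hpre.Icc_subset ⟨x, hx, by simp⟩ ⟨y, hy, rfl⟩
  have : volume (Icc 0 (dist x y)) ≤ ENNReal.ofReal d := by
    calc volume (Icc 0 (dist x y)) ≤ volume ((fun z : E3 => dist x z) '' S) := measure_mono hsub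
      _ = μH[1] ((fun z : E3 => dist x z) '' S) := by rw [hausdorffMeasure_real]
      _ ≤ μH[1] S := by simpa using (hlip.lipschitzOnWith (s := S)).hausdorffMeasure_image_le zero_le_one
      _ ≤ _ := hsum
  rw [Real.volume_Icc, sub_zero] at this
  exact (ENNReal.ofReal_le_ofReal_iff hd).1 this

/-- slicing: for some level in `[lo, hi]`, each connected piece of the slice has small diameter -/
lemma slice {X : Set E3} (η : ℝ) (hη : 0 < η) (hX : μH[2] X ≤ ENNReal.ofReal η)
    (ℓ : E3 → ℝ) (hℓ : LipschitzWith 1 ℓ) (lo hi d : ℝ) (hlh : lo < hi)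
    (hd : 2 * η ≤ d * (hi - lo)) :
    ∃ t ∈ Icc lo hi, ∀ S ⊆ X, IsPreconnected S → (∀ x ∈ S, ℓ x = t) →
      ∀ x ∈ S, ∀ y ∈ S, dist x y ≤ d := by
  have hd0 : 0 ≤ d := by
    by_contra! h
    nlinarith
  obtain ⟨t, hcov, hdiam, hsum⟩ : ∃ t : ℕ → Set E3, X ⊆ ⋃ n, t n ∧ (∀ n, Metric.ediam (t n) ≤ 1) ∧
      ∑' n, (Metric.ediam (t n)) ^ 2 ≤ ENNReal.ofReal (2 * η) := by
    have hlt : μH[2] X < ENNReal.ofReal (2 * η) :=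
      hX.trans_lt ((ENNReal.ofReal_lt_ofReal_iff (by linarith)).2 (by linarith))
    rw [Measure.hausdorffMeasure_apply] at hlt
    have h1 := (le_iSup₂ (f := fun (r : ENNReal) (_ : 0 < r) => ⨅ (t : ℕ → Set E3) (_ : X ⊆ ⋃ n, t n) (_ : ∀ n, Metric.ediam (t n) ≤ r),
          ∑' n, ⨆ _ : (t n).Nonempty, Metric.ediam (t n) ^ (2:ℝ)) 1 one_pos).trans_lt hlt
    simp only [iInf_lt_iff] at h1
    obtain ⟨t, h1, h2, h3⟩ := h1
    refine ⟨t, h1, h2, le_trans (ENNReal.tsum_le_tsum fun n => ?_) h3.le⟩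
    rcases (t n).eq_empty_or_nonempty with h | h
    · simp [h]
    · simp [h]
  -- intervals
  let I : ℕ → Set ℝ := fun n => closure (ℓ '' t n)
  let g : ℝ → ENNReal := fun s => ∑' n, (I n).indicator (fun _ => Metric.ediam (t n)) s
  have hgm : Measurable g := Measurable.ennreal_tsum fun n =>
    measurable_const.indicator isClosed_closure.measurableSet
  have hint : ∫⁻ s in Icc lo hi, g s ≤ ENNReal.ofReal (2 * η) := by
    calc ∫⁻ s in Icc lo hi, g s ≤ ∫⁻ s, g s := setLIntegral_le_lintegral _ _
      _ = ∑' n, ∫⁻ s, (I n).indicator (fun _ => Metric.ediam (t n)) s :=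
        lintegral_tsum fun n => (measurable_const.indicator isClosed_closure.measurableSet).aemeasurable
      _ ≤ ∑' n, (Metric.ediam (t n)) ^ 2 := by
        refine ENNReal.tsum_le_tsum fun n => ?_
        rw [lintegral_indicator isClosed_closure.measurableSet, lintegral_const, sq]
        gcongr
        rw [Measure.restrict_apply_univ]
        refine (Real.volume_le_diam _).trans ?_
        rw [Metric.ediam_closure]
        simpa using hℓ.ediam_image_le (t n)
      _ ≤ _ := hsum
  have hvol : volume (Icc lo hi) ≠ 0 := by
    rw [Real.volume_Icc]; simpa using hlh
  obtain ⟨s, hs, hgs⟩ := exists_le_setLAverage (μ := volume) (s := Icc lo hi) (f := g) hvol (by simp) hgm.aemeasurable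
  refine ⟨s, hs, fun S hSX hS hSl x hx y hy => ?_⟩
  have hgd : g s ≤ ENNReal.ofReal d := by
    refine hgs.trans ?_
    rw [setLAverage_eq]
    refine ENNReal.div_le_of_le_mul (hint.trans ?_)
    rw [Real.volume_Icc, ← ENNReal.ofReal_mul hd0]
    exact ENNReal.ofReal_le_ofReal hd
  refine dist_le_of_cover hS (fun n => {z | z ∈ t n ∧ s ∈ I n}) ?_ d hd0 (le_trans ?_ hgd) hx hy
  · intro z hz
    obtain ⟨n, hn⟩ := mem_iUnion.1 (hcov (hSX hz))
    exact mem_iUnion.2 ⟨n, hn, subset_closure ⟨z, hn, hSl z hz⟩⟩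
  · refine ENNReal.tsum_le_tsum fun n => ?_
    by_cases h : s ∈ I n
    · simp [h]
    · simp [h]

lemma step {X : Type*} [TopologicalSpace X] [T2Space X] [CompactSpace X]
    (hlift : ∀ u : C(X, Circle), ∃ h : C(X, ℝ), ∀ x, ee (h x) = u x)
    (ε : ℝ) (hε : 0 < ε) (hε' : ε < 1 / 10000) (γ T : ℝ → E3)
    (hderiv : ∀ s, HasDerivAt γ (T s) s)
    (hunit : ∀ s, ‖T s‖ = 1)
    (hclose : ∀ s t : ℝ, |s - t| ≤ 1 → ‖T s - T t‖ ≤ ε)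
    (F : X → E3) (hF : Continuous F) (hArea : μH[2] (range F) ≤ ENNReal.ofReal (ε ^ 2))
    (p : ℝ → X) (a b : ℝ) (hp : ContinuousOn p (Icc a b)) (hFp : ∀ s ∈ Icc a b, F (p s) = γ s)
    (hab : 1 ≤ b - a) (A : Set X) (hA : IsPreconnected A) (haA : p a ∈ A) (hbA : p b ∈ A)
    (hdiam : ∀ x ∈ A, ∀ y ∈ A, dist (F x) (F y) ≤ 2 * ε) :
    ∃ a' b' : ℝ, a + ε ≤ a' ∧ b' ≤ b ∧ 1 ≤ b' - a' ∧ ∃ A' : Set X, IsPreconnected A' ∧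
      p a' ∈ A' ∧ p b' ∈ A' ∧ ∀ x ∈ A', ∀ y ∈ A', dist (F x) (F y) ≤ 2 * ε := by
  let ℓ : E3 → ℝ := fun x => inner ℝ (T a) (x - γ a)
  have hℓ : LipschitzWith 1 ℓ := by
    refine LipschitzWith.of_dist_le_mul fun x y => ?_
    have : ℓ x - ℓ y = inner ℝ (T a) (x - y) := by
      simp only [ℓ, ← inner_sub_right]; congr 1; abel
    rw [Real.dist_eq, this, dist_eq_norm]
    refine (abs_real_inner_le_norm _ _).trans ?_
    simp [hunit]
  have hTa : ∀ s ∈ Icc a (a + 2), 1 / 2 < inner ℝ (T a) (T s) := by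
    intro s hs
    have h1 : ‖T s - T a‖ ≤ 2 * ε := by
      have e1 := hclose s ((s + a) / 2) (by rw [abs_le]; constructor <;> linarith [hs.1, hs.2])
      have e2 := hclose ((s + a) / 2) a (by rw [abs_le]; constructor <;> linarith [hs.1, hs.2])
      have : T s - T a = (T s - T ((s + a) / 2)) + (T ((s + a) / 2) - T a) := by abel
      rw [this]
      exact (norm_add_le _ _).trans (by linarith)
    have h2 : inner ℝ (T a) (T s) = 1 + inner ℝ (T a) (T s - T a) := by
      rw [inner_sub_right, real_inner_self_eq_norm_sq, hunit]; ring
    have h3 := abs_le.1 (abs_real_inner_le_norm (T a) (T s - T a))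
    rw [hunit, one_mul] at h3
    rw [h2]; linarith [h3.1]
  have hgd : ∀ s, HasDerivAt (fun s => ℓ (γ s) - s / 2) (inner ℝ (T a) (T s) - 1 / 2) s := by
    intro s
    have := (hasDerivAt_const s (T a)).inner ℝ ((hderiv s).sub_const (γ a))
    simp only [inner_zero_left, add_zero] at this
    exact this.sub ((hasDerivAt_id s).div_const 2)
  have hmono : StrictMonoOn (fun s => ℓ (γ s) - s / 2) (Icc a (a + 2)) := by
    refine strictMonoOn_of_deriv_pos (convex_Icc _ _)
      (fun s _ => (hgd s).continuousAt.continuousWithinAt) ?_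
    intro s hs
    rw [interior_Icc] at hs
    rw [(hgd s).deriv]
    linarith [hTa s ⟨hs.1.le, hs.2.le⟩]
  have hm : ∀ s ∈ Icc a (a + 2), ∀ t ∈ Icc a (a + 2), s < t →
      ℓ (γ s) + (t - s) / 2 < ℓ (γ t) := by
    intro s hs t ht hst
    have := hmono hs ht hst
    simp only at this
    linarith
  have hℓa : ℓ (γ a) = 0 := by simp [ℓ]
  obtain ⟨t, ht, hslice⟩ := slice (ε ^ 2) (by positivity) hArea ℓ hℓ (3 * ε) (1 / 4) (2 * ε)
    (by linarith) (by nlinarith)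
  have hcont : Continuous fun s => ℓ (γ s) :=
    hℓ.continuous.comp (continuous_iff_continuousAt.2 fun s => (hderiv s).continuousAt)
  have hend : 1 / 2 < ℓ (γ (a + 1)) := by
    have := hm a ⟨le_rfl, by linarith⟩ (a + 1) ⟨by linarith, by linarith⟩ (by linarith)
    linarith
  obtain ⟨a', ha', hta'⟩ : t ∈ (fun s => ℓ (γ s)) '' Icc a (a + 1) := by
    refine intermediate_value_Icc (by linarith) hcont.continuousOn ⟨?_, ?_⟩
    · simp only [hℓa]; linarith [ht.1]
    · linarith [ht.2]
  simp only at hta'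
  have hlow : a + 3 * ε ≤ a' := by
    have hl : LipschitzWith 1 γ := by
      refine lipschitzWith_of_nnnorm_deriv_le (fun s => (hderiv s).differentiableAt) fun s => ?_
      rw [(hderiv s).deriv, ← NNReal.coe_le_coe]
      simp [hunit]
    have := (hℓ.comp hl).dist_le_mul a' a
    simp only [Function.comp, Real.dist_eq, hta', hℓa] at this
    rw [sub_zero, abs_of_nonneg (by linarith [ht.1] : (0:ℝ) ≤ t),
      abs_of_nonneg (by linarith [ha'.1] : 0 ≤ a' - a)] at this
    simp only [mul_one, NNReal.coe_one, one_mul] at this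
    linarith [ht.1]
  have haa : a < a' := by linarith
  have ha1 : a' < a + 1 := by
    rcases lt_or_eq_of_le ha'.2 with h | h
    · exact h
    · rw [h] at hta'; linarith [ht.2]
  obtain ⟨b', hb', hne, hcomp⟩ := topo hlift (fun x => ℓ (F x) - t)
    ((hℓ.continuous.comp hF).sub continuous_const) p a a' (a + 1) b hp haa ha1 (by linarith)
    (by
      intro s hs
      rw [hFp s ⟨hs.1, by linarith [hs.2]⟩]
      have := hm s ⟨hs.1, by linarith [hs.2]⟩ a' ⟨by linarith, by linarith⟩ hs.2
      linarith [hs.2])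
    (by
      intro s hs
      rw [hFp s ⟨by linarith [hs.1], by linarith [hs.2]⟩]
      have := hm a' ⟨by linarith, by linarith⟩ s ⟨by linarith [hs.1], by linarith [hs.2]⟩ hs.1
      linarith [hs.1])
    (by rw [hFp a' ⟨by linarith, by linarith⟩]; linarith) A hA haA hbA ε hε
    (by
      intro x hx
      have h1 := hℓ.dist_le_mul (F x) (F (p a))
      have h2 := hdiam x hx _ haA
      rw [hFp a ⟨le_rfl, by linarith⟩] at h1 h2
      rw [Real.dist_eq, hℓa] at h1
      simp only [NNReal.coe_one, one_mul, sub_zero] at h1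
      linarith [le_abs_self (ℓ (F x)), ht.1])
  have hKa : p a' ∈ {x | ℓ (F x) - t = 0} := by
    simp only [mem_setOf_eq]
    rw [hFp a' ⟨by linarith, by linarith⟩]; linarith
  have hlb : ℓ (γ b') = t := by
    have := connectedComponentIn_subset _ _ hcomp
    simp only [mem_setOf_eq] at this
    rw [hFp b' hb'] at this
    linarith
  refine ⟨a', b', by linarith, hb'.2, ?_, _, isPreconnected_connectedComponentIn,
    mem_connectedComponentIn hKa, hcomp, ?_⟩
  · by_contra! hlt
    rcases lt_or_gt_of_ne hne with h | h
    · have := hm b' ⟨hb'.1, by linarith⟩ a' ⟨by linarith, by linarith⟩ h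
      linarith
    · have := hm a' ⟨by linarith, by linarith⟩ b' ⟨hb'.1, by linarith⟩ h
      linarith
  · intro x hx y hy
    refine hslice (F '' connectedComponentIn {x | ℓ (F x) - t = 0} (p a')) (image_subset_range _ _)
      (isPreconnected_connectedComponentIn.image _ hF.continuousOn) ?_ _ ⟨x, hx, rfl⟩ _ ⟨y, hy, rfl⟩
    rintro _ ⟨z, hz, rfl⟩
    have := connectedComponentIn_subset _ _ hz
    simp only [mem_setOf_eq] at this
    linarith

lemma descent {X : Type*} [TopologicalSpace X] [T2Space X] [CompactSpace X]
    (hlift : ∀ u : C(X, Circle), ∃ h : C(X, ℝ), ∀ x, ee (h x) = u x)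
    (ε : ℝ) (hε : 0 < ε) (hε' : ε < 1 / 10000) (γ T : ℝ → E3)
    (hderiv : ∀ s, HasDerivAt γ (T s) s)
    (hunit : ∀ s, ‖T s‖ = 1)
    (hclose : ∀ s t : ℝ, |s - t| ≤ 1 → ‖T s - T t‖ ≤ ε)
    (F : X → E3) (hF : Continuous F) (hArea : μH[2] (range F) ≤ ENNReal.ofReal (ε ^ 2))
    (p : ℝ → X) (n : ℕ) : ∀ (a b : ℝ), b - a ≤ n * ε → ContinuousOn p (Icc a b) →
    (∀ s ∈ Icc a b, F (p s) = γ s) →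
    1 ≤ b - a → ∀ A : Set X, IsPreconnected A → p a ∈ A → p b ∈ A →
    (∀ x ∈ A, ∀ y ∈ A, dist (F x) (F y) ≤ 2 * ε) → False := by
  induction n with
  | zero => intro a b h _ _ h1; simp at h; linarith
  | succ n ih =>
    intro a b hn hp hFp hab A hA haA hbA hd
    obtain ⟨a', b', h1, h2, h3, A', hA', h4, h5, h6⟩ := step hlift ε hε hε' γ T hderiv hunit hclose
      F hF hArea p a b hp hFp hab A hA haA hbA hd
    have hsub : Icc a' b' ⊆ Icc a b := Icc_subset_Icc (by linarith) h2
    push_cast at hn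
    exact ih a' b' (by linarith) (hp.mono hsub) (fun s hs => hFp s (hsub hs)) h3 A' hA' h4 h5 h6

/-- **Proposition 3.2.** The collection `𝒮` is empty: there is no compact sub-segment
`Γ = γ₀([a,b]) ⊂ Γ₀` together with a piecewise smooth embedded curve `α ⊂ Σ` having the same
endpoints as `Γ`, such that `α ∪ Γ` bounds a topological disk in `Σ`, `Length(α) ≤ 2ε`,
`Length(Γ) ≥ 1` and `Length(Γ₀ ∖ Γ) ≥ 1`. -/
theorem stmt_12 (ε L : ℝ) (γ₀ T γ₁ : ℝ → E3) (f : ℝ × ℝ → E3)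
    (hε : 0 < ε) (hε' : ε < 1 / 10000)
    (hL : 1 ≤ L)
    (hper : Function.Periodic γ₀ L)
    (hinj : Set.InjOn γ₀ (Set.Ico 0 L))
    (hderiv : ∀ s, HasDerivAt γ₀ (T s) s)
    (hunit : ∀ s, ‖T s‖ = 1)
    (hclose : ∀ s t : ℝ, |s - t| ≤ 1 → ‖T s - T t‖ ≤ ε)
    (hγ₁c : Continuous γ₁)
    (hγ₁p : Function.Periodic γ₁ 1)
    (hγ₁i : Set.InjOn γ₁ (Set.Ico 0 1))
    (hdisj : Disjoint (Set.range γ₀) (Set.range γ₁))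
    (hf : ContDiff ℝ (⊤ : ℕ∞) f)
    (hfper : ∀ x y : ℝ, f (x + 1, y) = f (x, y))
    (hfinj : Set.InjOn f (Set.Ico (0 : ℝ) 1 ×ˢ Set.Icc (0 : ℝ) 1))
    (hfimm : ∀ p : ℝ × ℝ, p.2 ∈ Set.Icc (0 : ℝ) 1 → Function.Injective (fderiv ℝ f p))
    (hΓ₀ : f '' (Set.univ ×ˢ ({0} : Set ℝ)) = Set.range γ₀)
    (hΓ₁ : f '' (Set.univ ×ˢ ({1} : Set ℝ)) = Set.range γ₁)
    (hArea : μH[2] (annulusSet f) ≤ ENNReal.ofReal (ε ^ 2)) :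
    ¬ ∃ (a b : ℝ) (c : ℝ → E3),
        -- Γ = γ₀([a,b]) is a compact proper sub-segment of Γ₀
        a < b ∧ b - a < L ∧
        -- (iv) Length(Γ) ≥ 1 and Length(Γ₀ ∖ Γ) ≥ 1
        1 ≤ b - a ∧ 1 ≤ L - (b - a) ∧
        -- α = c([0,1]) is a piecewise smooth embedded curve in Σ
        ContinuousOn c (Set.Icc 0 1) ∧
        Set.InjOn c (Set.Icc 0 1) ∧
        PiecewiseSmooth c ∧
        c '' Set.Icc 0 1 ⊆ annulusSet f ∧
        -- (i) α has the same end-points as Γ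
        ({c 0, c 1} : Set E3) = {γ₀ a, γ₀ b} ∧
        -- (iii) Length(α) ≤ 2ε
        μH[1] (c '' Set.Icc 0 1) ≤ ENNReal.ofReal (2 * ε) ∧
        -- (ii) α ∪ Γ bounds a topological disk in Σ
        (∃ F : EuclideanSpace ℝ (Fin 2) → E3,
          ContinuousOn F (Metric.closedBall 0 1) ∧
          Set.InjOn F (Metric.closedBall 0 1) ∧
          F '' Metric.closedBall 0 1 ⊆ annulusSet f ∧
          F '' Metric.sphere 0 1 = c '' Set.Icc 0 1 ∪ γ₀ '' Set.Icc a b) := by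
  rintro ⟨a, b, c, -, -, hab, -, hc, -, -, -, hends, hlen, F, hFc, hFi, hFs, hFb⟩
  let Fx : Metric.closedBall (0 : EuclideanSpace ℝ (Fin 2)) 1 → E3 := fun x => F x
  have hFx : Continuous Fx := continuousOn_iff_continuous_restrict.1 hFc
  have hFxi : Function.Injective Fx := fun x y h => Subtype.ext (hFi x.2 y.2 h)
  have hcs : CompactSpace (Metric.closedBall (0 : EuclideanSpace ℝ (Fin 2)) 1) :=
    isCompact_iff_compactSpace.1 (isCompact_closedBall _ _)
  have hemb := (hFx.isClosedEmbedding hFxi).isEmbedding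
  have hrange : range Fx ⊆ annulusSet f := by
    rintro _ ⟨x, rfl⟩
    exact hFs ⟨x, x.2, rfl⟩
  have hinv : ∀ z ∈ c '' Set.Icc 0 1 ∪ γ₀ '' Set.Icc a b, ∃ x, Fx x = z := by
    intro z hz
    rw [← hFb] at hz
    obtain ⟨x, hx, rfl⟩ := hz
    exact ⟨⟨x, Metric.sphere_subset_closedBall hx⟩, rfl⟩
  have hne : Nonempty (Metric.closedBall (0 : EuclideanSpace ℝ (Fin 2)) 1) := ⟨⟨0, by simp⟩⟩
  let G := Function.invFun Fx
  have hG : ∀ z ∈ c '' Set.Icc 0 1 ∪ γ₀ '' Set.Icc a b, Fx (G z) = z :=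
    fun z hz => Function.invFun_eq (hinv z hz)
  have hγG : ∀ s ∈ Icc a b, Fx (G (γ₀ s)) = γ₀ s := fun s hs => hG _ (Or.inr ⟨s, hs, rfl⟩)
  have hcG : ∀ s ∈ Icc (0 : ℝ) 1, Fx (G (c s)) = c s := fun s hs => hG _ (Or.inl ⟨s, hs, rfl⟩)
  have hγc : Continuous γ₀ := continuous_iff_continuousAt.2 fun s => (hderiv s).continuousAt
  have hp : ContinuousOn (fun s => G (γ₀ s)) (Icc a b) :=
    hemb.continuousOn_iff.2 (hγc.continuousOn.congr hγG)
  have hq : ContinuousOn (fun s => G (c s)) (Icc 0 1) :=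
    hemb.continuousOn_iff.2 (hc.congr hcG)
  have hmem : ∀ z ∈ ({γ₀ a, γ₀ b} : Set E3), G z ∈ (fun s => G (c s)) '' Icc 0 1 := by
    intro z hz
    rw [← hends] at hz
    rcases hz with rfl | hz
    · exact ⟨0, by simp, rfl⟩
    · rw [mem_singleton_iff.1 hz]
      exact ⟨1, by simp, rfl⟩
  obtain ⟨n, hn⟩ := exists_nat_ge ((b - a) / ε)
  refine descent ball_lift ε hε hε' γ₀ T hderiv hunit hclose Fx hFx
    ((measure_mono hrange).trans hArea) (fun s => G (γ₀ s)) n a b ((div_le_iff₀ hε).1 hn) hp hγG hab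
    ((fun s => G (c s)) '' Icc 0 1) (isPreconnected_Icc.image _ hq) (hmem _ (by simp))
    (hmem _ (by simp)) ?_
  rintro _ ⟨s, hs, rfl⟩ _ ⟨t, ht, rfl⟩
  simp only
  rw [hcG s hs, hcG t ht]
  exact dist_le_of_H1 (isPreconnected_Icc.image _ hc) _ (by positivity) hlen ⟨s, hs, rfl⟩ ⟨t, ht, rfl⟩
end
end
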